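/- arXiv:2303.00784 — 3 statements merged into one kernel-verified Lean document; each statement's English description precedes it below -/
import Mathlib

section
/- Let u ∈ C_c^∞(ℝ^n) with ‖u‖_{L_2(γ_n)} = 1 and suppose ∫_{ℝ^n} x_i x_j u(x)² dγ_n(x) = δ_{ij} for all i, j ∈ {1,…,n}, where δ_{ij} is the Kronecker delta. Then Ent_{γ_n}[u²] ≤ (1/2) log det( 4 ∫_{ℝ^n} (∇u)^{⊗2} dγ_n + Id_n ). -/
open MeasureTheory

/-- The `k`-th partial derivative of a function on `ℝⁿ`. -/
noncomputable def pderiv' {n : ℕ} (f : (Fin n → ℝ) → ℝ) (k : Fin n) (x : Fin n → ℝ) : ℝ :=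
  fderiv ℝ f x (Pi.single k 1)

/-- The standard Gaussian measure `γₙ` on `ℝⁿ`. -/
noncomputable def stdGauss (n : ℕ) : Measure (Fin n → ℝ) :=
  volume.withDensity fun x =>
    ENNReal.ofReal ((2 * Real.pi) ^ (-(n : ℝ) / 2) * Real.exp (-(∑ i, x i ^ 2) / 2))

open Set Filter Topology ProbabilityTheory

theorem hasDerivAt_integral_Iic {q : ℝ → ℝ} (hq : Continuous q) (hi : Integrable q) (x : ℝ) :
    HasDerivAt (fun y => ∫ t in Iic y, q t) (q x) x := by
  have h : (fun y => ∫ t in Iic y, q t) =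
      fun y => (∫ t in Iic (0 : ℝ), q t) + ∫ t in (0 : ℝ)..y, q t := by
    funext y
    rw [← intervalIntegral.integral_Iic_sub_Iic hi.integrableOn hi.integrableOn]
    ring
  rw [h]
  exact (intervalIntegral.integral_hasDerivAt_right (hq.intervalIntegrable _ _)
    (hq.stronglyMeasurableAtFilter _ _) hq.continuousAt).const_add _

theorem strictMono_integral_Iic {q : ℝ → ℝ} (hq : Continuous q) (hi : Integrable q)
    (hpos : ∀ x, 0 < q x) : StrictMono (fun y => ∫ t in Iic y, q t) :=
  strictMono_of_deriv_pos fun x => by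
    rw [(hasDerivAt_integral_Iic hq hi x).deriv]; exact hpos x

theorem integral_Iic_add_Ioi' {q : ℝ → ℝ} (hi : Integrable q) (x : ℝ) :
    (∫ t in Iic x, q t) + ∫ t in Ioi x, q t = ∫ t, q t := by
  rw [← compl_Iic]; exact integral_add_compl measurableSet_Iic hi

theorem integral_Iic_pos {q : ℝ → ℝ} (hi : Integrable q)
    (hpos : ∀ x, 0 < q x) (x : ℝ) : 0 < ∫ t in Iic x, q t := by
  rw [setIntegral_pos_iff_support_of_nonneg_ae (ae_of_all _ fun t => (hpos t).le) hi.integrableOn]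
  have : Function.support q = univ := by ext t; simp [(hpos t).ne']
  simp [this]

theorem integral_Ioi_pos {q : ℝ → ℝ} (hi : Integrable q)
    (hpos : ∀ x, 0 < q x) (x : ℝ) : 0 < ∫ t in Ioi x, q t := by
  rw [setIntegral_pos_iff_support_of_nonneg_ae (ae_of_all _ fun t => (hpos t).le) hi.integrableOn]
  have : Function.support q = univ := by ext t; simp [(hpos t).ne']
  simp [this]

theorem exists_transport {p q : ℝ → ℝ} (hp : Continuous p) (hip : Integrable p)
    (hppos : ∀ x, 0 < p x) (hq : Continuous q) (hiq : Integrable q) (hqpos : ∀ x, 0 < q x)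
    (hpq : ∫ t, p t = ∫ t, q t) :
    ∃ T : ℝ → ℝ, (∀ x, ∫ t in Iic (T x), q t = ∫ t in Iic x, p t) ∧
      ∀ x, HasDerivAt T (p x / q (T x)) x := by
  set Q : ℝ → ℝ := fun y => ∫ t in Iic y, q t with hQ
  have hQd := hasDerivAt_integral_Iic hq hiq
  have hQc : Continuous Q := continuous_iff_continuousAt.2 fun x => (hQd x).continuousAt
  have hmono : StrictMono Q := strictMono_integral_Iic hq hiq hqpos
  have hbot : Tendsto Q atBot (𝓝 0) := by
    exact tendsto_integral_Iic_zero tendsto_id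
  have htop : Tendsto Q atTop (𝓝 (∫ t, q t)) := by
    exact (aecover_Iic tendsto_id).integral_tendsto_of_countably_generated hiq
  have hrange : range Q = Ioo 0 (∫ t, q t) := by
    apply Subset.antisymm
    · rintro _ ⟨x, rfl⟩
      refine ⟨integral_Iic_pos hiq hqpos x, ?_⟩
      have := integral_Iic_add_Ioi' hiq x
      have := integral_Ioi_pos hiq hqpos x
      simp only [hQ]; linarith
    · intro y hy
      exact mem_range_of_exists_le_of_exists_ge hQc
        ((hbot.eventually (gt_mem_nhds hy.1)).exists.imp fun _ h => h.le)
        ((htop.eventually (lt_mem_nhds hy.2)).exists.imp fun _ h => h.le)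
  have hopen : IsOpenEmbedding Q :=
    ⟨hmono.isEmbedding_of_ordConnected (hrange ▸ ordConnected_Ioo), hrange ▸ isOpen_Ioo⟩
  let e := hopen.toOpenPartialHomeomorph Q
  have hmem : ∀ x, (∫ t in Iic x, p t) ∈ e.target := by
    intro x
    have : e.target = Ioo 0 (∫ t, q t) := by
      rw [← hrange]; simp [e]
    rw [this]
    have h1 := integral_Iic_add_Ioi' hip x
    have h2 := integral_Ioi_pos hip hppos x
    exact ⟨integral_Iic_pos hip hppos x, by linarith⟩
  refine ⟨fun x => e.symm (∫ t in Iic x, p t), fun x => e.right_inv (hmem x), fun x => ?_⟩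
  have h1 := e.hasDerivAt_symm (hmem x) (hqpos _).ne' (hQd _)
  have h2 := h1.comp x (hasDerivAt_integral_Iic hp hip x)
  rw [div_eq_inv_mul]
  exact h2

section StandardGaussian

local notation "φ" => gaussianPDFReal 0 1

theorem gaussianPDFReal_std (x : ℝ) : φ x = (√(2 * Real.pi))⁻¹ * Real.exp (-x ^ 2 / 2) := by
  simp [gaussianPDFReal]

theorem continuous_gaussianPDFReal_std : Continuous φ := by
  simp_rw [funext gaussianPDFReal_std]; fun_prop

theorem gaussianPDFReal_std_pos (x : ℝ) : 0 < φ x := gaussianPDFReal_pos 0 1 x one_ne_zero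

theorem hasDerivAt_gaussianPDFReal_std (x : ℝ) : HasDerivAt φ (-x * φ x) x := by
  rw [funext gaussianPDFReal_std]
  have h : HasDerivAt (fun y : ℝ => -y ^ 2 / 2) (-(2 * x) / 2) x := by
    simpa using ((hasDerivAt_pow 2 x).fun_neg).div_const 2
  refine (h.exp.const_mul (√(2 * Real.pi))⁻¹).congr_deriv ?_
  ring

theorem tendsto_gaussianPDFReal_std : Tendsto φ atTop (𝓝 0) := by
  rw [funext gaussianPDFReal_std, ← mul_zero (√(2 * Real.pi))⁻¹]
  refine (Real.tendsto_exp_atBot.comp ?_).const_mul _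
  exact ((tendsto_neg_atTop_atBot.comp (tendsto_pow_atTop two_ne_zero)).atBot_div_const two_pos)

theorem gaussianPDFReal_std_neg (x : ℝ) : φ (-x) = φ x := by simp [gaussianPDFReal_std]

/-- Shifting the upper tail of the standard Gaussian by one gains an exponential factor. -/
theorem integral_Ioi_gaussianPDFReal_le {c x : ℝ} (h : Real.exp (-x) ≤ c) :
    ∫ t in Ioi (x + 1), φ t ≤ c * ∫ t in Ioi x, φ t := by
  have hint := integrable_gaussianPDFReal 0 1
  have h1 : ∫ t in Ioi (x + 1), φ t = ∫ t in Ioi x, φ (t + 1) := by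
    have := (measurePreserving_add_right volume (1 : ℝ)).setIntegral_preimage_emb
      (measurableEmbedding_addRight 1) φ (Ioi (x + 1))
    simpa using this.symm
  rw [h1, ← integral_const_mul]
  refine setIntegral_mono_on (hint.comp_add_right 1).integrableOn (hint.const_mul c).integrableOn
    measurableSet_Ioi fun t ht => ?_
  have h2 : φ (t + 1) = Real.exp (-t - 1 / 2) * φ t := by
    rw [gaussianPDFReal_std, gaussianPDFReal_std, mul_left_comm, ← Real.exp_add]
    ring_nf
  rw [h2]
  refine mul_le_mul_of_nonneg_right (le_trans (Real.exp_le_exp.2 ?_) h)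
    (gaussianPDFReal_std_pos t).le
  have : x < t := ht
  linarith

theorem integral_Iic_gaussianPDFReal_le {c x : ℝ} (h : Real.exp x ≤ c) :
    ∫ t in Iic (x - 1), φ t ≤ c * ∫ t in Iic x, φ t := by
  have key : ∀ y, ∫ t in Iic y, φ t = ∫ t in Ioi (-y), φ t := fun y => by
    rw [← integral_comp_neg_Iic]; simp_rw [gaussianPDFReal_std_neg]
  rw [key, key, show -(x - 1) = -x + 1 by ring]
  exact integral_Ioi_gaussianPDFReal_le (by simpa using h)

/-- The truncated Gaussian logarithmic Sobolev inequality on the line, by monotone transport. -/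
theorem intervalIntegral_entropy_le {p p' : ℝ → ℝ} {c M : ℝ} (hc : 0 < c)
    (hp : ∀ x, HasDerivAt p (p' x) x) (hp' : Continuous p') (hlow : ∀ x, c ≤ p x)
    (hup : ∀ x, p x ≤ M) (hone : ∫ x, p x * φ x = 1) {R : ℝ} (hR : 0 ≤ R)
    (hRc : Real.exp (-R) ≤ c) :
    ∫ x in (-R)..R, φ x * (p x * Real.log (p x)) ≤
      2 * M * φ R + ∫ x in (-R)..R, φ x * (p' x ^ 2 / (2 * p x)) := by
  have hφ := continuous_gaussianPDFReal_std
  have hφi := integrable_gaussianPDFReal 0 1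
  have hpc : Continuous p := continuous_iff_continuousAt.2 fun x => (hp x).continuousAt
  have hpos : ∀ x, 0 < p x := fun x => hc.trans_le (hlow x)
  have hφpos := gaussianPDFReal_std_pos
  have hi : Integrable fun x => p x * φ x := by
    refine hφi.bdd_mul hpc.aestronglyMeasurable (c := M) (ae_of_all _ fun x => ?_)
    rw [Real.norm_of_nonneg (hpos x).le]; exact hup x
  obtain ⟨T, hT, hTd⟩ := exists_transport (p := fun x => p x * φ x) (hpc.mul hφ) hi
    (fun x => mul_pos (hpos x) (hφpos x))
    hφ hφi hφpos (by rw [hone, integral_gaussianPDFReal_eq_one 0 one_ne_zero])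
  have hTc : Continuous T := continuous_iff_continuousAt.2 fun x => (hTd x).continuousAt
  have hmono := strictMono_integral_Iic hφ hφi hφpos
  have hleft : -R - 1 ≤ T (-R) := by
    rw [← hmono.le_iff_le, hT]
    refine (integral_Iic_gaussianPDFReal_le hRc).trans ?_
    rw [← integral_const_mul]
    exact setIntegral_mono (hφi.const_mul c).integrableOn hi.integrableOn
      fun t => mul_le_mul_of_nonneg_right (hlow t) (hφpos t).le
  have hright : T R ≤ R + 1 := by
    rw [← hmono.le_iff_le, hT]
    have h1 := integral_Iic_add_Ioi' hφi (R + 1)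
    have h2 := integral_Iic_add_Ioi' hi R
    have h3 : ∫ t in Ioi (R + 1), φ t ≤ ∫ t in Ioi R, p t * φ t := by
      refine (integral_Ioi_gaussianPDFReal_le hRc).trans ?_
      rw [← integral_const_mul]
      exact setIntegral_mono (hφi.const_mul c).integrableOn hi.integrableOn
        fun t => mul_le_mul_of_nonneg_right (hlow t) (hφpos t).le
    rw [integral_gaussianPDFReal_eq_one 0 one_ne_zero] at h1
    linarith
  set T' : ℝ → ℝ := fun x => p x * φ x / φ (T x) with hT'
  have hT'c : Continuous T' := (hpc.mul hφ).div (hφ.comp hTc) fun x => (hφpos _).ne'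
  set H' : ℝ → ℝ := fun x => (p' x * φ x + p x * (-x * φ x)) * (T x - x) + p x * φ x * (T' x - 1)
    with hH'
  have hH : ∀ x, HasDerivAt (fun x => p x * φ x * (T x - x)) (H' x) x := fun x =>
    ((hp x).mul (hasDerivAt_gaussianPDFReal_std x)).mul ((hTd x).sub (hasDerivAt_id x))
  have hH'c : Continuous H' := by fun_prop
  have hFTC : ∫ x in (-R)..R, H' x = p R * φ R * (T R - R) - p (-R) * φ (-R) * (T (-R) - -R) :=
    intervalIntegral.integral_eq_sub_of_hasDerivAt (fun x _ => hH x) (hH'c.intervalIntegrable _ _)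
  have hpoint : ∀ x, φ x * (p x * Real.log (p x)) ≤ H' x + φ x * (p' x ^ 2 / (2 * p x)) := by
    intro x
    have hlog : Real.log (p x) = Real.log (T' x) + (x ^ 2 - T x ^ 2) / 2 := by
      have : p x = T' x * Real.exp ((x ^ 2 - T x ^ 2) / 2) := by
        rw [hT']
        simp only [gaussianPDFReal_std]
        rw [mul_left_comm, mul_div_mul_left _ _ (by positivity), mul_div_assoc, ← Real.exp_sub,
          mul_assoc, ← Real.exp_add]
        ring_nf; simp
      have hT'pos : 0 < T' x := div_pos (mul_pos (hpos x) (hφpos x)) (hφpos _)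
      conv_lhs => rw [this]
      rw [Real.log_mul hT'pos.ne' (Real.exp_pos _).ne', Real.log_exp]
    have hT'pos : 0 < T' x := div_pos (mul_pos (hpos x) (hφpos x)) (hφpos _)
    have h1 := Real.log_le_sub_one_of_pos hT'pos
    have h2 : Real.log (p x) ≤ T' x - 1 + (x ^ 2 - T x ^ 2) / 2 := by linarith
    have h3 : p x * Real.log (p x) ≤ p x * (T' x - 1 + (x ^ 2 - T x ^ 2) / 2) :=
      mul_le_mul_of_nonneg_left h2 (hpos x).le
    have h4 : 0 ≤ p x / 2 * ((T x - x) + p' x / p x) ^ 2 := by have := hpos x; positivity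
    have h5 : p x / 2 * ((T x - x) + p' x / p x) ^ 2 =
        p x * (T x - x) ^ 2 / 2 + p' x * (T x - x) + p' x ^ 2 / (2 * p x) := by
      have := (hpos x).ne'
      field_simp; ring
    have h6 : p x * Real.log (p x) ≤ (p' x - p x * x) * (T x - x) + p x * (T' x - 1)
        + p' x ^ 2 / (2 * p x) := by nlinarith
    have h7 := mul_le_mul_of_nonneg_left h6 (hφpos x).le
    refine h7.trans (le_of_eq ?_)
    simp only [hH']; ring
  have hcont1 : Continuous fun x => φ x * (p x * Real.log (p x)) :=
    hφ.mul (hpc.mul (hpc.log fun x => (hpos x).ne'))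
  have hcont2 : Continuous fun x => φ x * (p' x ^ 2 / (2 * p x)) :=
    hφ.mul ((hp'.pow 2).div (hpc.const_mul 2) fun x => (mul_pos two_pos (hpos x)).ne')
  have hint : ∫ x in (-R)..R, φ x * (p x * Real.log (p x)) ≤
      ∫ x in (-R)..R, (H' x + φ x * (p' x ^ 2 / (2 * p x))) :=
    intervalIntegral.integral_mono_on (by linarith) (hcont1.intervalIntegrable _ _)
      ((hH'c.add hcont2).intervalIntegrable _ _) fun x _ => hpoint x
  rw [intervalIntegral.integral_add (hH'c.intervalIntegrable _ _)
    (hcont2.intervalIntegrable _ _), hFTC, gaussianPDFReal_std_neg] at hint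
  have e1 : p R * φ R * (T R - R) ≤ M * φ R := by
    have : p R * φ R * (T R - R) ≤ p R * φ R * 1 :=
      mul_le_mul_of_nonneg_left (by linarith) (mul_pos (hpos R) (hφpos R)).le
    have := mul_le_mul_of_nonneg_right (hup R) (hφpos R).le
    linarith
  have e2 : -(p (-R) * φ R * (T (-R) - -R)) ≤ M * φ R := by
    have : p (-R) * φ R * (-(T (-R) - -R)) ≤ p (-R) * φ R * 1 :=
      mul_le_mul_of_nonneg_left (by linarith) (mul_pos (hpos (-R)) (hφpos R)).le
    have := mul_le_mul_of_nonneg_right (hup (-R)) (hφpos R).le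
    linarith
  linarith

/-- The entropy functional of a function with respect to a measure. -/
noncomputable def entropy {α : Type*} [MeasurableSpace α] (μ : Measure α) (f : α → ℝ) : ℝ :=
  (∫ x, f x * Real.log (f x) ∂μ) - (∫ x, f x ∂μ) * Real.log (∫ x, f x ∂μ)

/-- The Gaussian logarithmic Sobolev inequality on the line. -/
theorem entropy_gaussianReal_le {w : ℝ → ℝ} (hw : ContDiff ℝ 1 w) {B ε : ℝ} (hε : 0 < ε)
    (hB : ∀ x, |w x| ≤ B) (hB' : ∀ x, |deriv w x| ≤ B) :
    entropy (gaussianReal 0 1) (fun x => w x ^ 2 + ε) ≤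
      2 * ∫ x, deriv w x ^ 2 ∂(gaussianReal 0 1) := by
  have hwc := hw.continuous
  have hw'c : Continuous (deriv w) := hw.continuous_deriv le_rfl
  have hφi := integrable_gaussianPDFReal 0 1
  have hφpos := gaussianPDFReal_std_pos
  have hbdd : ∀ x, w x ^ 2 ≤ B ^ 2 := fun x => sq_le_sq' (abs_le.1 (hB x)).1 (abs_le.1 (hB x)).2
  have hbdd' : ∀ x, deriv w x ^ 2 ≤ B ^ 2 :=
    fun x => sq_le_sq' (abs_le.1 (hB' x)).1 (abs_le.1 (hB' x)).2
  have hg : ∀ x, 0 < w x ^ 2 + ε := fun x => by positivity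
  simp only [entropy, integral_gaussianReal_eq_integral_smul one_ne_zero, smul_eq_mul]
  have hbi : ∀ {f : ℝ → ℝ} (C : ℝ), Continuous f → (∀ x, |f x| ≤ C) →
      Integrable fun x => φ x * f x := fun C hf hC =>
    hφi.mul_bdd hf.aestronglyMeasurable (c := C) (ae_of_all _ hC)
  have hgi : Integrable fun x => φ x * (w x ^ 2 + ε) :=
    hbi (B ^ 2 + ε) (by fun_prop) fun x => by rw [abs_of_pos (hg x)]; linarith [hbdd x]
  set m : ℝ := ∫ x, φ x * (w x ^ 2 + ε) with hm
  have hεm : ε ≤ m := by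
    have : ∫ x, φ x * ε ≤ m := integral_mono (hφi.mul_const ε) hgi fun x =>
      mul_le_mul_of_nonneg_left (by nlinarith [sq_nonneg (w x)]) (hφpos x).le
    rwa [integral_mul_const, integral_gaussianPDFReal_eq_one 0 one_ne_zero, one_mul] at this
  have hmpos : 0 < m := hε.trans_le hεm
  set p : ℝ → ℝ := fun x => (w x ^ 2 + ε) / m with hp
  set p' : ℝ → ℝ := fun x => 2 * w x * deriv w x / m with hp'
  have hpd : ∀ x, HasDerivAt p (p' x) x := fun x => by
    have h1 : HasDerivAt w (deriv w x) x := ((hw.differentiable one_ne_zero) x).hasDerivAt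
    simpa using (((h1.fun_pow 2).add_const ε).div_const m)
  have hp'c : Continuous p' := by fun_prop
  have hpc : Continuous p := by fun_prop
  have hppos : ∀ x, 0 < p x := fun x => div_pos (hg x) hmpos
  have hlow : ∀ x, ε / m ≤ p x := fun x => by
    simp only [hp]; gcongr; nlinarith [sq_nonneg (w x)]
  have hup : ∀ x, p x ≤ (B ^ 2 + ε) / m := fun x => by
    exact div_le_div_of_nonneg_right (by linarith [hbdd x]) hmpos.le
  have hone : ∫ x, p x * φ x = 1 := by
    have : (fun x => p x * φ x) = fun x => φ x * (w x ^ 2 + ε) / m := by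
      funext x; simp only [hp]; ring
    rw [this, integral_div, ← hm, div_self hmpos.ne']
  have hder : ∀ x, p' x ^ 2 / (2 * p x) ≤ 2 * deriv w x ^ 2 / m := fun x => by
    have : p' x ^ 2 / (2 * p x) = w x ^ 2 / (w x ^ 2 + ε) * (2 * deriv w x ^ 2 / m) := by
      simp only [hp, hp']
      have := (hg x).ne'
      field_simp
    rw [this]
    refine mul_le_of_le_one_left (by positivity) ?_
    rw [div_le_one (hg x)]; linarith
  have hfin : Integrable fun x => φ x * (p x * Real.log (p x)) := by
    obtain ⟨C, hC⟩ :=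
      (isCompact_Icc (a := ε / m) (b := (B ^ 2 + ε) / m)).exists_bound_of_continuousOn
      Real.continuous_mul_log.continuousOn
    exact hbi C (hpc.mul (hpc.log fun x => (hppos x).ne')) fun x => hC (p x) ⟨hlow x, hup x⟩
  have hfin' : Integrable fun x => φ x * (2 * deriv w x ^ 2 / m) :=
    hbi (2 * B ^ 2 / m) (by fun_prop) fun x => by
      rw [abs_of_nonneg (by positivity)]
      exact div_le_div_of_nonneg_right (by linarith [hbdd' x]) hmpos.le
  have hlim1 := intervalIntegral_tendsto_integral hfin tendsto_neg_atTop_atBot tendsto_id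
  have hlim2 := intervalIntegral_tendsto_integral hfin' tendsto_neg_atTop_atBot tendsto_id
  have hlim3 := (tendsto_gaussianPDFReal_std.const_mul (2 * ((B ^ 2 + ε) / m))).add hlim2
  have hφc := continuous_gaussianPDFReal_std
  have hle := le_of_tendsto_of_tendsto hlim1 hlim3 (by
    have hexp : ∀ᶠ R : ℝ in atTop, Real.exp (-R) ≤ ε / m :=
      (Real.tendsto_exp_neg_atTop_nhds_zero.eventually (gt_mem_nhds (div_pos hε hmpos))).mono
        fun _ h => h.le
    filter_upwards [hexp, eventually_ge_atTop 0] with R hR hR0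
    refine (intervalIntegral_entropy_le (div_pos hε hmpos) hpd hp'c hlow hup hone hR0 hR).trans ?_
    simp only [id]
    gcongr
    refine intervalIntegral.integral_mono_on (by linarith) ?_ ?_ fun x _ =>
      mul_le_mul_of_nonneg_left (hder x) (hφpos x).le
    · exact (hφc.mul ((hp'c.pow 2).div (hpc.const_mul 2)
        fun x => (mul_pos two_pos (hppos x)).ne')).intervalIntegrable _ _
    · exact (hφc.mul (by fun_prop)).intervalIntegrable _ _)
  rw [mul_zero, zero_add] at hle
  have e1 : ∀ x, φ x * (p x * Real.log (p x)) =
      m⁻¹ * (φ x * ((w x ^ 2 + ε) * Real.log (w x ^ 2 + ε))) -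
        m⁻¹ * Real.log m * (φ x * (w x ^ 2 + ε)) := fun x => by
    simp only [hp]; rw [Real.log_div (hg x).ne' hmpos.ne']; ring
  have hgl : Integrable fun x => φ x * ((w x ^ 2 + ε) * Real.log (w x ^ 2 + ε)) := by
    obtain ⟨C, hC⟩ := (isCompact_Icc (a := ε) (b := B ^ 2 + ε)).exists_bound_of_continuousOn
      Real.continuous_mul_log.continuousOn
    refine hbi C (Continuous.mul (by fun_prop) (Continuous.log (by fun_prop) fun x => (hg x).ne'))
      fun x => hC (w x ^ 2 + ε) ⟨by nlinarith [sq_nonneg (w x)], by linarith [hbdd x]⟩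
  have e2 : ∀ x, φ x * (2 * deriv w x ^ 2 / m) = m⁻¹ * (2 * (φ x * deriv w x ^ 2)) := fun x => by
    ring
  simp only [e1, e2] at hle
  rw [integral_sub (hgl.const_mul _) (hgi.const_mul _), integral_const_mul, integral_const_mul,
    integral_const_mul, integral_const_mul, ← hm, mul_assoc, ← mul_sub,
    mul_le_mul_iff_right₀ (inv_pos.2 hmpos)] at hle
  linarith

end StandardGaussian

theorem exists_abs_mul_log_le (c M : ℝ) : ∃ C, ∀ t, c ≤ t → t ≤ M → |t * Real.log t| ≤ C := by
  obtain ⟨C, hC⟩ := (isCompact_Icc (a := c) (b := M)).exists_bound_of_continuousOn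
    Real.continuous_mul_log.continuousOn
  exact ⟨C, fun t h1 h2 => hC t ⟨h1, h2⟩⟩

theorem integral_mem_Icc_of_bounds {α : Type*} [MeasurableSpace α] {μ : Measure α}
    [IsProbabilityMeasure μ] {f : α → ℝ} {c M : ℝ} (hf : Measurable f) (hlow : ∀ x, c ≤ f x)
    (hup : ∀ x, f x ≤ M) : Integrable f μ ∧ c ≤ ∫ x, f x ∂μ ∧ ∫ x, f x ∂μ ≤ M := by
  have hi : Integrable f μ := Integrable.of_mem_Icc c M hf.aemeasurable
    (ae_of_all _ fun x => ⟨hlow x, hup x⟩)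
  refine ⟨hi, ?_, ?_⟩
  · simpa using integral_mono (integrable_const c) hi hlow
  · simpa using integral_mono hi (integrable_const M) hup

theorem integrable_mul_log {α : Type*} [MeasurableSpace α] {μ : Measure α}
    [IsProbabilityMeasure μ] {f : α → ℝ} {c M : ℝ} (hf : Measurable f) (hlow : ∀ x, c ≤ f x)
    (hup : ∀ x, f x ≤ M) : Integrable (fun x => f x * Real.log (f x)) μ := by
  obtain ⟨C, hC⟩ := exists_abs_mul_log_le c M
  exact Integrable.of_bound (hf.mul hf.log).aestronglyMeasurable C
    (ae_of_all _ fun x => hC _ (hlow x) (hup x))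

section Tensorization

variable {α β : Type*} [MeasurableSpace α] [MeasurableSpace β] {μ : Measure α} {ν : Measure β}
  [IsProbabilityMeasure μ] [IsProbabilityMeasure ν]

/-- Integrating out the second variable of the entropy in the first one. -/
theorem integral_entropy_section {g : α × β → ℝ} {c M : ℝ} (hg : Measurable g)
    (hlow : ∀ z, c ≤ g z) (hup : ∀ z, g z ≤ M) :
    Integrable (fun y => entropy μ fun x => g (x, y)) ν ∧
    ∫ y, entropy μ (fun x => g (x, y)) ∂ν = (∫ z, g z * Real.log (g z) ∂(μ.prod ν)) -
      ∫ y, (∫ x, g (x, y) ∂μ) * Real.log (∫ x, g (x, y) ∂μ) ∂ν := by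
  have h1 : Integrable (fun z => g z * Real.log (g z)) (μ.prod ν) := integrable_mul_log hg hlow hup
  have hGm : Measurable fun y => ∫ x, g (x, y) ∂μ :=
    (hg.stronglyMeasurable.integral_prod_left').measurable
  have hG := fun y => integral_mem_Icc_of_bounds (μ := μ) (f := fun x => g (x, y))
    (hg.comp (measurable_id.prodMk measurable_const)) (fun x => hlow _) fun x => hup _
  have h2 : Integrable (fun y => (∫ x, g (x, y) ∂μ) * Real.log (∫ x, g (x, y) ∂μ)) ν :=
    integrable_mul_log hGm (fun y => (hG y).2.1) fun y => (hG y).2.2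
  refine ⟨h1.integral_prod_right.sub h2, ?_⟩
  simp only [entropy]
  rw [integral_sub h1.integral_prod_right h2, integral_prod_symm _ h1]

/-- Subadditivity of entropy on a product of two probability spaces. -/
theorem entropy_prod_le {g : α × β → ℝ} {c M : ℝ} (hc : 0 < c) (hg : Measurable g)
    (hlow : ∀ z, c ≤ g z) (hup : ∀ z, g z ≤ M) :
    entropy (μ.prod ν) g ≤ (∫ y, entropy μ (fun x => g (x, y)) ∂ν) +
      ∫ x, entropy ν (fun y => g (x, y)) ∂μ := by
  have hswap : ∫ x, entropy ν (fun y => g (x, y)) ∂μ = (∫ z, g z * Real.log (g z) ∂(μ.prod ν)) -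
      ∫ x, (∫ y, g (x, y) ∂ν) * Real.log (∫ y, g (x, y) ∂ν) ∂μ := by
    have := (integral_entropy_section (μ := ν) (ν := μ) (g := g ∘ Prod.swap)
      (hg.comp measurable_swap) (fun z => hlow _) fun z => hup _).2
    simp only [Function.comp_apply, Prod.swap_prod_mk] at this
    rw [this, ← integral_prod_swap (μ := μ) (ν := ν)]
  rw [hswap, (integral_entropy_section hg hlow hup).2, entropy]
  set G : β → ℝ := fun y => ∫ x, g (x, y) ∂μ with hGdef
  set K : α → ℝ := fun x => ∫ y, g (x, y) ∂ν with hKdef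
  have hGm : Measurable G := (hg.stronglyMeasurable.integral_prod_left').measurable
  have hKm : Measurable K := (hg.stronglyMeasurable.integral_prod_right').measurable
  have hG := fun y => integral_mem_Icc_of_bounds (μ := μ) (f := fun x => g (x, y))
    (hg.comp (measurable_id.prodMk measurable_const)) (fun x => hlow _) fun x => hup _
  have hK := fun x => integral_mem_Icc_of_bounds (μ := ν) (f := fun y => g (x, y))
    (hg.comp (measurable_const.prodMk measurable_id)) (fun y => hlow _) fun y => hup _
  obtain ⟨hgi, hm1, hm2⟩ := integral_mem_Icc_of_bounds (μ := μ.prod ν) hg hlow hup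
  have hgl : Integrable (fun z => g z * Real.log (g z)) (μ.prod ν) := integrable_mul_log hg hlow hup
  set m : ℝ := ∫ z, g z ∂(μ.prod ν) with hm
  have hmpos : 0 < m := hc.trans_le hm1
  have hGpos : ∀ y, 0 < G y := fun y => hc.trans_le (hG y).2.1
  have hKpos : ∀ x, 0 < K x := fun x => hc.trans_le (hK x).2.1
  have hgpos : ∀ z, 0 < g z := fun z => hc.trans_le (hlow z)
  have hlogb : ∀ t, c ≤ t → t ≤ M → ‖Real.log t‖ ≤ max |Real.log c| |Real.log M| := fun t h1 h2 =>
    abs_le_max_abs_abs (Real.log_le_log hc h1) (Real.log_le_log (hc.trans_le h1) h2)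
  have hiG : Integrable (fun z : α × β => g z * Real.log (G z.2)) (μ.prod ν) :=
    hgi.mul_bdd (c := max |Real.log c| |Real.log M|)
      (hGm.log.comp measurable_snd).aestronglyMeasurable
      (ae_of_all _ fun z => hlogb _ (hG z.2).2.1 (hG z.2).2.2)
  have hiK : Integrable (fun z : α × β => g z * Real.log (K z.1)) (μ.prod ν) :=
    hgi.mul_bdd (c := max |Real.log c| |Real.log M|)
      (hKm.log.comp measurable_fst).aestronglyMeasurable
      (ae_of_all _ fun z => hlogb _ (hK z.1).2.1 (hK z.1).2.2)
  have hGi : Integrable G ν := (integral_mem_Icc_of_bounds hGm (fun y => (hG y).2.1)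
    fun y => (hG y).2.2).1
  have hKi : Integrable K μ := (integral_mem_Icc_of_bounds hKm (fun y => (hK y).2.1)
    fun y => (hK y).2.2).1
  have hKG : Integrable (fun z : α × β => K z.1 * G z.2) (μ.prod ν) := hKi.mul_prod hGi
  have eG : ∫ z, g z * Real.log (G z.2) ∂(μ.prod ν) = ∫ y, G y * Real.log (G y) ∂ν := by
    rw [integral_prod_symm _ hiG]; simp only [integral_mul_const, hGdef]
  have eK : ∫ z, g z * Real.log (K z.1) ∂(μ.prod ν) = ∫ x, K x * Real.log (K x) ∂μ := by
    rw [integral_prod _ hiK]; simp only [integral_mul_const, hKdef]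
  have eKG : ∫ z : α × β, K z.1 * G z.2 ∂(μ.prod ν) = m * m := by
    rw [integral_prod_mul K G, hm]
    nth_rewrite 1 [integral_prod _ hgi]
    rw [integral_prod_symm _ hgi]
  have hpoint : ∀ z : α × β, g z * Real.log (G z.2) + g z * Real.log (K z.1) - g z * Real.log m ≤
      g z * Real.log (g z) + (K z.1 * G z.2 / m - g z) := fun z => by
    have h1 := Real.log_le_sub_one_of_pos
      (div_pos (mul_pos (hKpos z.1) (hGpos z.2)) (mul_pos hmpos (hgpos z)))
    rw [Real.log_div (mul_pos (hKpos _) (hGpos _)).ne' (mul_pos hmpos (hgpos _)).ne',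
      Real.log_mul (hKpos _).ne' (hGpos _).ne', Real.log_mul hmpos.ne' (hgpos _).ne'] at h1
    have h2 := mul_le_mul_of_nonneg_left h1 (hgpos z).le
    have h3 : g z * (K z.1 * G z.2 / (m * g z) - 1) = K z.1 * G z.2 / m - g z := by
      have := (hgpos z).ne'
      field_simp
    rw [h3] at h2
    linarith
  have hGK : Integrable (fun z : α × β => g z * Real.log (G z.2) + g z * Real.log (K z.1))
      (μ.prod ν) := hiG.add hiK
  have hKGm : Integrable (fun z : α × β => K z.1 * G z.2 / m - g z) (μ.prod ν) :=
    (hKG.div_const m).sub hgi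
  have hint := integral_mono (hGK.sub (hgi.mul_const (Real.log m)))
    (hgl.add hKGm) hpoint
  simp only [Pi.add_apply, Pi.sub_apply] at hint
  rw [integral_sub hGK (hgi.mul_const _), integral_add hiG hiK,
    integral_add hgl hKGm, integral_sub (hKG.div_const m) hgi,
    integral_mul_const, integral_div, eKG, eG, eK, ← hm, mul_div_assoc, div_self hmpos.ne'] at hint
  linarith

end Tensorization

theorem integral_pi_gaussianReal_succ {n : ℕ} (f : (Fin (n + 1) → ℝ) → ℝ) :
    ∫ x, f x ∂(Measure.pi fun _ : Fin (n + 1) => gaussianReal 0 1) =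
      ∫ z : ℝ × (Fin n → ℝ), f (Fin.cons z.1 z.2)
        ∂((gaussianReal 0 1).prod (Measure.pi fun _ : Fin n => gaussianReal 0 1)) := by
  have h := (measurePreserving_piFinSuccAbove (fun _ : Fin (n + 1) => gaussianReal 0 1) 0).symm
  rw [← h.integral_comp (MeasurableEquiv.measurableEmbedding _)]
  simp [MeasurableEquiv.piFinSuccAbove, Fin.consEquiv]

theorem pderiv'_zero_cons {n : ℕ} {w : (Fin (n + 1) → ℝ) → ℝ} (hw : Differentiable ℝ w) (s : ℝ)
    (y : Fin n → ℝ) :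
    deriv (fun t : ℝ => w (Fin.cons t y)) s = pderiv' w 0 (Fin.cons s y) := by
  have h : HasDerivAt (fun t : ℝ => (Fin.cons t y : Fin (n + 1) → ℝ)) (Pi.single 0 1) s := by
    rw [hasDerivAt_pi]
    intro i
    cases i using Fin.cases with
    | zero => simpa using hasDerivAt_id' s
    | succ i => simpa using hasDerivAt_const s (y i)
  exact ((hw _).hasFDerivAt.comp_hasDerivAt s h).deriv

theorem contDiff_cons {n : ℕ} :
    ContDiff ℝ 1 fun z : ℝ × (Fin n → ℝ) => (Fin.cons z.1 z.2 : Fin (n + 1) → ℝ) := by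
  rw [contDiff_pi]
  intro i
  cases i using Fin.cases with
  | zero => simpa using contDiff_fst
  | succ i => simpa using! (contDiff_apply ℝ ℝ i).comp contDiff_snd

theorem pderiv'_succ_cons {n : ℕ} {w : (Fin (n + 1) → ℝ) → ℝ} (hw : Differentiable ℝ w) (s : ℝ)
    (y : Fin n → ℝ) (i : Fin n) :
    pderiv' (fun t : Fin n → ℝ => w (Fin.cons s t)) i y = pderiv' w i.succ (Fin.cons s y) := by
  have h : HasFDerivAt (fun t : Fin n → ℝ => (Fin.cons s t : Fin (n + 1) → ℝ))
      ((Fin.consEquivL ℝ (fun _ : Fin (n + 1) => ℝ) : _ →L[ℝ] _).comp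
        (ContinuousLinearMap.inr ℝ ℝ (Fin n → ℝ))) y := by
    rw [hasFDerivAt_pi']
    intro j
    cases j using Fin.cases with
    | zero => 
      refine (hasFDerivAt_const s y).congr_fderiv ?_
      ext; simp
    | succ j => 
      refine ((ContinuousLinearMap.proj (R := ℝ)
        (φ := fun _ : Fin n => ℝ) j).hasFDerivAt).congr_fderiv ?_
      ext; simp
  have h2 := ((hw (Fin.cons s y)).hasFDerivAt.comp y h).fderiv
  simp only [pderiv']
  have h3 : (Fin.cons 0 (Pi.single i 1) : Fin (n + 1) → ℝ) = Pi.single i.succ 1 := by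
    ext j
    cases j using Fin.cases with
    | zero => simp
    | succ j => simp [Pi.single_apply]
  change fderiv ℝ (w ∘ fun t : Fin n → ℝ => (Fin.cons s t : Fin (n + 1) → ℝ)) y _ = _
  rw [h2, ← h3]
  simp [Fin.consEquivL]
  rfl

theorem continuous_pderiv' {n : ℕ} {w : (Fin n → ℝ) → ℝ} (hw : ContDiff ℝ 1 w) (i : Fin n) :
    Continuous (pderiv' w i) :=
  (hw.continuous_fderiv one_ne_zero).clm_apply continuous_const

/-- The Gaussian logarithmic Sobolev inequality in `ℝⁿ`, for squares bounded away from zero. -/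
theorem entropy_pi_gaussianReal_add_le {n : ℕ} {w : (Fin n → ℝ) → ℝ} (hw : ContDiff ℝ 1 w)
    {B ε : ℝ} (hε : 0 < ε) (hB : ∀ x, |w x| ≤ B) (hB' : ∀ i x, |pderiv' w i x| ≤ B) :
    entropy (Measure.pi fun _ : Fin n => gaussianReal 0 1) (fun x => w x ^ 2 + ε) ≤
      2 * ∑ i, ∫ x, pderiv' w i x ^ 2 ∂(Measure.pi fun _ : Fin n => gaussianReal 0 1) := by
  induction n with
  | zero =>
    simp [entropy, integral_unique]
  | succ n ih =>
    have hwd := hw.differentiable one_ne_zero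
    have hbdd : ∀ x, w x ^ 2 ≤ B ^ 2 := fun x => sq_le_sq' (abs_le.1 (hB x)).1 (abs_le.1 (hB x)).2
    set γ := gaussianReal 0 1
    set π := Measure.pi fun _ : Fin n => gaussianReal 0 1
    have hcons : Continuous fun z : ℝ × (Fin n → ℝ) => (Fin.cons z.1 z.2 : Fin (n + 1) → ℝ) :=
      contDiff_cons.continuous
    set g : ℝ × (Fin n → ℝ) → ℝ := fun z => w (Fin.cons z.1 z.2) ^ 2 + ε
    have hg : Measurable g := (((hw.continuous.comp hcons).pow 2).add_const ε).measurable
    have hlow : ∀ z, ε ≤ g z := fun z => le_add_of_nonneg_left (sq_nonneg _)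
    have hup : ∀ z, g z ≤ B ^ 2 + ε := fun z => by simpa [g] using hbdd _
    have hent : entropy (Measure.pi fun _ : Fin (n + 1) => gaussianReal 0 1)
        (fun x => w x ^ 2 + ε) = entropy (γ.prod π) g := by
      simp only [entropy, integral_pi_gaussianReal_succ]; rfl
    have hDi : ∀ i, Integrable (fun z : ℝ × (Fin n → ℝ) => pderiv' w i (Fin.cons z.1 z.2) ^ 2)
        (γ.prod π) := fun i =>
      Integrable.of_bound (((continuous_pderiv' hw i).comp hcons).pow 2).aestronglyMeasurable
        (B ^ 2)
        (ae_of_all _ fun z => by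
          rw [Real.norm_of_nonneg (sq_nonneg _)]
          exact sq_le_sq' (abs_le.1 (hB' i _)).1 (abs_le.1 (hB' i _)).2)
    have h1 : ∫ y, entropy γ (fun s => g (s, y)) ∂π ≤
        2 * ∫ z : ℝ × (Fin n → ℝ), pderiv' w 0 (Fin.cons z.1 z.2) ^ 2 ∂(γ.prod π) := by
      rw [integral_prod_symm _ (hDi 0), ← integral_const_mul]
      refine integral_mono (integral_entropy_section hg hlow hup).1
        ((hDi 0).integral_prod_right.const_mul 2) fun y => ?_
      have := entropy_gaussianReal_le (w := fun s => w (Fin.cons s y))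
        (hw.comp (contDiff_cons.comp (contDiff_id.prodMk contDiff_const))) hε (B := B)
        (fun x => hB _) fun x => by rw [pderiv'_zero_cons hwd]; exact hB' _ _
      simpa only [pderiv'_zero_cons hwd] using this
    have h2 : ∫ s, entropy π (fun y => g (s, y)) ∂γ ≤
        2 * ∑ i : Fin n, ∫ z : ℝ × (Fin n → ℝ), pderiv' w i.succ (Fin.cons z.1 z.2) ^ 2
          ∂(γ.prod π) := by
      simp_rw [integral_prod _ (hDi _)]
      rw [← integral_finsetSum _ fun i _ => (hDi _).integral_prod_left, ← integral_const_mul]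
      refine integral_mono (integral_entropy_section (g := g ∘ Prod.swap)
          (hg.comp measurable_swap) (fun z => hlow _) fun z => hup _).1
        ((integrable_finsetSum _ fun i _ => (hDi _).integral_prod_left).const_mul 2) fun s => ?_
      have := ih (w := fun y => w (Fin.cons s y))
        (hw.comp (contDiff_cons.comp (contDiff_const.prodMk contDiff_id)))
        (fun x => hB _) fun i x => by rw [pderiv'_succ_cons hwd]; exact hB' _ _
      simpa only [pderiv'_succ_cons hwd] using this
    rw [hent, Fin.sum_univ_succ]
    rw [integral_pi_gaussianReal_succ]
    rw [Finset.sum_congr rfl fun i _ =>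
      integral_pi_gaussianReal_succ fun x => pderiv' w (Fin.succ i) x ^ 2]
    have := entropy_prod_le (μ := γ) (ν := π) hε hg hlow hup
    linarith

theorem prod_gaussianPDFReal {n : ℕ} (x : Fin n → ℝ) :
    ∏ i, gaussianPDFReal 0 1 (x i) =
      (2 * Real.pi) ^ (-(n : ℝ) / 2) * Real.exp (-(∑ i, x i ^ 2) / 2) := by
  simp only [gaussianPDFReal_std, Finset.prod_mul_distrib, ← Real.exp_sum, Finset.prod_const,
    Finset.card_univ, Fintype.card_fin]
  congr 1
  · rw [Real.sqrt_eq_rpow, ← Real.rpow_neg (by positivity), ← Real.rpow_natCast,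
      ← Real.rpow_mul (by positivity)]
    ring_nf
  · rw [← Finset.sum_div, Finset.sum_neg_distrib]

theorem stdGauss_eq_pi (n : ℕ) : stdGauss n = Measure.pi fun _ : Fin n => gaussianReal 0 1 := by
  symm
  apply Measure.pi_eq
  intro s hs
  simp only [stdGauss, ← prod_gaussianPDFReal]
  have hS : MeasurableSet (univ.pi s) := MeasurableSet.univ_pi hs
  rw [withDensity_apply _ hS, ← lintegral_indicator hS]
  have h1 : (univ.pi s).indicator (fun x => ENNReal.ofReal (∏ i, gaussianPDFReal 0 1 (x i))) =
      fun x : Fin n → ℝ =>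
        ENNReal.ofReal (∏ i, (s i).indicator (gaussianPDFReal 0 1) (x i)) := by
    funext x
    by_cases hx : x ∈ univ.pi s
    · rw [indicator_of_mem hx]
      congr 1
      exact Finset.prod_congr rfl fun i _ => (indicator_of_mem (hx i (mem_univ i)) _).symm
    · rw [indicator_of_notMem hx]
      obtain ⟨i, hi⟩ : ∃ i, x i ∉ s i := by simpa using hx
      rw [Finset.prod_eq_zero (Finset.mem_univ i) (indicator_of_notMem hi _), ENNReal.ofReal_zero]
  have h2 : ∀ i, Integrable ((s i).indicator (gaussianPDFReal 0 1)) :=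
    fun i => (integrable_gaussianPDFReal 0 1).indicator (hs i)
  have h3 : ∀ i t, 0 ≤ (s i).indicator (gaussianPDFReal 0 1) t :=
    fun i => indicator_nonneg fun t _ => gaussianPDFReal_nonneg 0 1 t
  have h4 : Integrable fun x : Fin n → ℝ => ∏ i, (s i).indicator (gaussianPDFReal 0 1) (x i) :=
    Integrable.fintype_prod h2
  rw [h1, ← ofReal_integral_eq_lintegral_ofReal h4
    (ae_of_all _ fun x => Finset.prod_nonneg fun i _ => h3 i _),
    integral_fintype_prod_volume_eq_prod fun i => (s i).indicator (gaussianPDFReal 0 1),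
    ENNReal.ofReal_prod_of_nonneg fun i _ => integral_nonneg (h3 i)]
  refine Finset.prod_congr rfl fun i _ => ?_
  rw [integral_indicator (hs i), gaussianReal_apply_eq_integral 0 one_ne_zero]

theorem integral_stdGauss {n : ℕ} (f : (Fin n → ℝ) → ℝ) :
    ∫ x, f x ∂(stdGauss n) = ∫ x, (∏ i, gaussianPDFReal 0 1 (x i)) * f x := by
  rw [stdGauss, integral_withDensity_eq_integral_toReal_smul (by fun_prop) (by simp)]
  simp only [← prod_gaussianPDFReal, smul_eq_mul]
  refine integral_congr_ae (ae_of_all _ fun x => ?_)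
  simp only
  rw [ENNReal.toReal_ofReal (Finset.prod_nonneg fun i _ => gaussianPDFReal_nonneg 0 1 _)]

/-- The Gaussian logarithmic Sobolev inequality in `ℝⁿ`. -/
theorem entropy_stdGauss_le {n : ℕ} {w : (Fin n → ℝ) → ℝ} (hw : ContDiff ℝ 1 w)
    (hc : HasCompactSupport w) :
    entropy (stdGauss n) (fun x => w x ^ 2) ≤
      2 * ∑ i, ∫ x, pderiv' w i x ^ 2 ∂(stdGauss n) := by
  rw [stdGauss_eq_pi]
  set π := Measure.pi fun _ : Fin n => gaussianReal 0 1
  obtain ⟨C, hC⟩ := hc.exists_bound_of_continuous hw.continuous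
  have hC' : ∀ i, ∃ C', ∀ x, |pderiv' w i x| ≤ C' := fun i =>
    (hc.fderiv_apply (𝕜 := ℝ) (Pi.single i 1)).exists_bound_of_continuous (continuous_pderiv' hw i)
  choose C' hC' using hC'
  set B := max C (∑ i, |C' i|)
  have hB : ∀ x, |w x| ≤ B := fun x => (hC x).trans (le_max_left _ _)
  have hB' : ∀ i x, |pderiv' w i x| ≤ B := fun i x =>
    (hC' i x).trans ((le_abs_self _).trans ((Finset.single_le_sum
      (f := fun i => |C' i|) (fun j _ => abs_nonneg _) (Finset.mem_univ i)).trans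
        (le_max_right _ _)))
  have hbdd : ∀ x, w x ^ 2 ≤ B ^ 2 := fun x => sq_le_sq' (abs_le.1 (hB x)).1 (abs_le.1 (hB x)).2
  have hwc := hw.continuous
  have h1 : Tendsto (fun ε : ℝ => ∫ x, (w x ^ 2 + ε) ∂π) (𝓝[>] 0) (𝓝 (∫ x, w x ^ 2 ∂π)) := by
    refine tendsto_integral_filter_of_dominated_convergence (fun _ => B ^ 2 + 1)
      (Eventually.of_forall fun ε => (by fun_prop : Continuous _).aestronglyMeasurable) ?_
      (integrable_const _) (ae_of_all _ fun x => ?_)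
    · filter_upwards [Ioo_mem_nhdsGT (zero_lt_one' ℝ)] with ε hε
      refine ae_of_all _ fun x => ?_
      rw [Real.norm_of_nonneg (add_nonneg (sq_nonneg _) hε.1.le)]
      linarith [hbdd x, hε.2]
    · have : Continuous fun ε : ℝ => w x ^ 2 + ε := by fun_prop
      simpa using (this.tendsto 0).mono_left nhdsWithin_le_nhds
  have h2 : Tendsto (fun ε : ℝ => ∫ x, (w x ^ 2 + ε) * Real.log (w x ^ 2 + ε) ∂π) (𝓝[>] 0)
      (𝓝 (∫ x, w x ^ 2 * Real.log (w x ^ 2) ∂π)) := by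
    obtain ⟨D, hD⟩ := exists_abs_mul_log_le 0 (B ^ 2 + 1)
    refine tendsto_integral_filter_of_dominated_convergence (fun _ => D)
      (Eventually.of_forall fun ε => (Real.continuous_mul_log.comp
        (by fun_prop : Continuous fun x => w x ^ 2 + ε)).aestronglyMeasurable) ?_
      (integrable_const _) (ae_of_all _ fun x => ?_)
    · filter_upwards [Ioo_mem_nhdsGT (zero_lt_one' ℝ)] with ε hε
      exact ae_of_all _ fun x => hD _ (add_nonneg (sq_nonneg _) hε.1.le)
        (by linarith [hbdd x, hε.2])
    · have : Continuous fun ε : ℝ => (w x ^ 2 + ε) * Real.log (w x ^ 2 + ε) :=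
        Real.continuous_mul_log.comp (by fun_prop : Continuous fun ε : ℝ => w x ^ 2 + ε)
      simpa using (this.tendsto 0).mono_left nhdsWithin_le_nhds
  have h3 := h2.sub ((Real.continuous_mul_log.tendsto _).comp h1)
  refine le_of_tendsto h3 ?_
  filter_upwards [self_mem_nhdsWithin] with ε hε
  exact entropy_pi_gaussianReal_add_le hw hε hB hB'

theorem hasCompactSupport_pderiv' {n : ℕ} {v : (Fin n → ℝ) → ℝ} (hc : HasCompactSupport v)
    (i : Fin n) : HasCompactSupport (pderiv' v i) :=
  hc.fderiv_apply (𝕜 := ℝ) (Pi.single i 1)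

theorem hasCompactSupport_sq {α : Type*} [TopologicalSpace α] {v : α → ℝ}
    (hc : HasCompactSupport v) : HasCompactSupport fun x => v x ^ 2 :=
  hc.comp_left (g := fun t : ℝ => t ^ 2) (by norm_num)

theorem integral_mul_pderiv'_mul_coord {n : ℕ} {v : (Fin n → ℝ) → ℝ} (hv : ContDiff ℝ 1 v)
    (hc : HasCompactSupport v) (i j : Fin n) :
    ∫ x, v x * pderiv' v i x * x j = -(1 / 2) * if i = j then ∫ x, v x ^ 2 else 0 := by
  have hvc := hv.continuous
  have hvd := hv.differentiable one_ne_zero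
  have hdc := continuous_pderiv' hv i
  have hsq : ∀ x, fderiv ℝ (fun y => v y ^ 2) x (Pi.single i 1) = 2 * v x * pderiv' v i x :=
    fun x => by
      rw [((hvd x).hasFDerivAt.pow 2).fderiv]
      simp [pderiv']
  have hcoord : ∀ x : Fin n → ℝ,
      fderiv ℝ (fun y : Fin n → ℝ => y j) x (Pi.single i 1) = if i = j then 1 else 0 := fun x => by
    rw [(hasFDerivAt_apply j x).fderiv]
    simp [Pi.single_apply, eq_comm]
  have h := integral_mul_fderiv_eq_neg_fderiv_mul_of_integrable (𝕜 := ℝ) (μ := volume)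
    (f := fun x => v x ^ 2)
    (g := fun x : Fin n → ℝ => x j) (v := Pi.single i 1) ?_ ?_ ?_
    (fun x _ => (hvd x).fun_pow 2) (fun x _ => differentiableAt_apply j x)
  · simp only [hsq, hcoord] at h
    have e : ∀ x : Fin n → ℝ, 2 * v x * pderiv' v i x * x j = 2 * (v x * pderiv' v i x * x j) :=
      fun x => by ring
    simp only [e] at h
    rw [integral_const_mul, integral_mul_const] at h
    split_ifs at h ⊢ <;> linarith
  · simp only [hsq]
    exact Continuous.integrable_of_hasCompactSupport (by fun_prop)
      ((hc.mul_left (f := fun _ => 2)).mul_right.mul_right)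
  · simp only [hcoord]
    exact Continuous.integrable_of_hasCompactSupport (by fun_prop)
      ((hasCompactSupport_sq hc).mul_right)
  · exact Continuous.integrable_of_hasCompactSupport (by fun_prop)
      ((hasCompactSupport_sq hc).mul_right)

/-- The function `x ↦ K exp (a |x|²)`. -/
noncomputable def gaussWeight {n : ℕ} (K a : ℝ) (x : Fin n → ℝ) : ℝ :=
  K * Real.exp (a * ∑ j, x j ^ 2)

theorem contDiff_gaussWeight {n : ℕ} (K a : ℝ) : ContDiff ℝ 1 (gaussWeight (n := n) K a) := by
  unfold gaussWeight; fun_prop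

theorem pderiv'_mul_gaussWeight {n : ℕ} {f : (Fin n → ℝ) → ℝ} (hf : ContDiff ℝ 1 f) (K a : ℝ)
    (i : Fin n) (x : Fin n → ℝ) :
    pderiv' (fun y => f y * gaussWeight K a y) i x =
      (pderiv' f i x + 2 * a * x i * f x) * gaussWeight K a x := by
  have h1 : HasFDerivAt (fun y : Fin n → ℝ => ∑ j, y j ^ 2)
      (∑ j, (2 * x j) • ContinuousLinearMap.proj (R := ℝ) (φ := fun _ : Fin n => ℝ) j) x := by
    refine HasFDerivAt.fun_sum fun j _ => ?_
    have h : HasFDerivAt (fun y : Fin n → ℝ => y j)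
        (ContinuousLinearMap.proj (R := ℝ) (φ := fun _ : Fin n => ℝ) j) x :=
      hasFDerivAt_apply j x
    simpa using h.pow 2
  have h2 := ((hf.differentiable one_ne_zero) x).hasFDerivAt.fun_mul
    ((h1.const_mul a).exp.const_mul K)
  simp only [pderiv', gaussWeight]
  rw [HasFDerivAt.fderiv h2]
  simp [Pi.single_apply]
  ring

theorem integrable_mul_of_hasCompactSupport {n : ℕ} {f g : (Fin n → ℝ) → ℝ} (hf : Continuous f)
    (hc : HasCompactSupport f) (hg : Continuous g) : Integrable fun x => f x * g x :=
  (hf.mul hg).integrable_of_hasCompactSupport hc.mul_right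

theorem integrable_sq_mul_log_sq {n : ℕ} {v : (Fin n → ℝ) → ℝ} (hv : Continuous v)
    (hc : HasCompactSupport v) : Integrable fun x => v x ^ 2 * Real.log (v x ^ 2) := by
  have h : Continuous fun x => v x ^ 2 * Real.log (v x ^ 2) :=
    Real.continuous_mul_log.comp (hv.pow 2)
  exact h.integrable_of_hasCompactSupport (hasCompactSupport_sq hc).mul_right

/-- The Euclidean logarithmic Sobolev inequality, in linear form. -/
theorem integral_sq_mul_log_sq_le {n : ℕ} {v : (Fin n → ℝ) → ℝ} (hv : ContDiff ℝ 1 v)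
    (hc : HasCompactSupport v) (hone : ∫ x, v x ^ 2 = 1) :
    ∫ x, v x ^ 2 * Real.log (v x ^ 2) ≤
      2 * ∑ i, (∫ x, pderiv' v i x ^ 2) - n - n / 2 * Real.log (2 * Real.pi) := by
  have hvc := hv.continuous
  set σ : (Fin n → ℝ) → ℝ := gaussWeight ((2 * Real.pi) ^ ((n : ℝ) / 4)) (1 / 4) with hσ
  have hσpos : ∀ x, 0 < σ x := fun x => by simp only [hσ, gaussWeight]; positivity
  have hσ2 : ∀ x, (∏ i, gaussianPDFReal 0 1 (x i)) * σ x ^ 2 = 1 := fun x => by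
    rw [prod_gaussianPDFReal, hσ, gaussWeight, mul_pow, ← Real.exp_nat_mul, mul_mul_mul_comm,
      ← Real.exp_add, ← Real.rpow_natCast, ← Real.rpow_mul (by positivity),
      ← Real.rpow_add (by positivity)]
    ring_nf; simp
  have hlog : ∀ x, Real.log (σ x ^ 2) = n / 2 * Real.log (2 * Real.pi) + (∑ i, x i ^ 2) / 2 :=
    fun x => by
      rw [hσ, gaussWeight, Real.log_pow, Real.log_mul (by positivity) (by positivity),
        Real.log_exp, Real.log_rpow (by positivity)]
      push_cast; ring
  have key := entropy_stdGauss_le (hv.mul (contDiff_gaussWeight _ _)) (hc.mul_right (f' := σ))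
  have hx2 : ∀ i, Integrable fun x : Fin n → ℝ => v x ^ 2 * x i ^ 2 := fun i =>
    integrable_mul_of_hasCompactSupport (by fun_prop)
      (hasCompactSupport_sq hc) (by fun_prop)
  have hv2 : Integrable fun x : Fin n → ℝ => v x ^ 2 :=
    (hvc.pow 2).integrable_of_hasCompactSupport (hasCompactSupport_sq hc)
  have hvl := integrable_sq_mul_log_sq hvc hc
  have e1 : ∫ x, (v x * σ x) ^ 2 ∂(stdGauss n) = 1 := by
    rw [integral_stdGauss, ← hone]
    refine integral_congr_ae (ae_of_all _ fun x => ?_)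
    linear_combination (v x ^ 2) * hσ2 x
  have e2 : ∫ x, (v x * σ x) ^ 2 * Real.log ((v x * σ x) ^ 2) ∂(stdGauss n) =
      (∫ x, v x ^ 2 * Real.log (v x ^ 2)) + n / 2 * Real.log (2 * Real.pi) +
        (∑ i, ∫ x, v x ^ 2 * x i ^ 2) / 2 := by
    have h : ∀ x, (∏ i, gaussianPDFReal 0 1 (x i)) *
        ((v x * σ x) ^ 2 * Real.log ((v x * σ x) ^ 2)) =
        v x ^ 2 * Real.log (v x ^ 2) + v x ^ 2 * (n / 2 * Real.log (2 * Real.pi)) +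
          (∑ i, v x ^ 2 * x i ^ 2) / 2 := fun x => by
      rcases eq_or_ne (v x) 0 with h0 | h0
      · simp [h0]
      · rw [mul_pow, Real.log_mul (pow_ne_zero 2 h0) (pow_ne_zero 2 (hσpos x).ne'), hlog,
          ← Finset.mul_sum]
        linear_combination (v x ^ 2 * (Real.log (v x ^ 2) +
          (n / 2 * Real.log (2 * Real.pi) + (∑ i, x i ^ 2) / 2))) * hσ2 x
    rw [integral_stdGauss]
    simp only [h]
    rw [integral_add (hvl.fun_add (hv2.mul_const _))
      ((integrable_finsetSum _ fun i _ => hx2 i).div_const 2),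
      integral_add hvl (hv2.mul_const _), integral_mul_const, hone, one_mul, integral_div,
      integral_finsetSum _ fun i _ => hx2 i]
  have e3 : ∀ i, ∫ x, pderiv' (fun y => v y * σ y) i x ^ 2 ∂(stdGauss n) =
      (∫ x, pderiv' v i x ^ 2) - 1 / 2 + (∫ x, v x ^ 2 * x i ^ 2) / 4 := fun i => by
    have hdc := continuous_pderiv' hv i
    have h : ∀ x, (∏ i, gaussianPDFReal 0 1 (x i)) * pderiv' (fun y => v y * σ y) i x ^ 2 =
        pderiv' v i x ^ 2 + v x * pderiv' v i x * x i + (v x ^ 2 * x i ^ 2) / 4 := fun x => by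
      rw [hσ, pderiv'_mul_gaussWeight hv, ← hσ]
      linear_combination ((pderiv' v i x + x i * v x / 2) ^ 2) * hσ2 x
    have i1 : Integrable fun x => pderiv' v i x ^ 2 :=
      (hdc.pow 2).integrable_of_hasCompactSupport
        (hasCompactSupport_sq (hasCompactSupport_pderiv' hc i))
    have i2 : Integrable fun x => v x * pderiv' v i x * x i :=
      integrable_mul_of_hasCompactSupport (hvc.mul hdc) hc.mul_right (by fun_prop)
    rw [integral_stdGauss]
    simp only [h]
    rw [integral_add (i1.fun_add i2) ((hx2 i).div_const 4), integral_add i1 i2,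
      integral_mul_pderiv'_mul_coord hv hc, if_pos rfl, hone, integral_div]
    ring
  have key' : (∫ x, (v x * σ x) ^ 2 * Real.log ((v x * σ x) ^ 2) ∂(stdGauss n)) -
      (∫ x, (v x * σ x) ^ 2 ∂(stdGauss n)) * Real.log (∫ x, (v x * σ x) ^ 2 ∂(stdGauss n)) ≤
      2 * ∑ i, ∫ x, pderiv' (fun y => v y * σ y) i x ^ 2 ∂(stdGauss n) := key
  rw [e1, e2, Real.log_one, mul_zero, sub_zero] at key'
  simp only [e3, Finset.sum_add_distrib, Finset.sum_sub_distrib, Finset.sum_const,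
    Finset.card_univ, Fintype.card_fin, nsmul_eq_mul, ← Finset.sum_div] at key'
  linarith

open scoped MatrixOrder Matrix.Norms.L2Operator in
theorem Matrix.PosDef.exists_transpose_mul_mul_eq_one {n : ℕ} {J : Matrix (Fin n) (Fin n) ℝ}
    (hJ : J.PosDef) : ∃ A : Matrix (Fin n) (Fin n) ℝ, A.det ≠ 0 ∧ A.transpose * J * A = 1 := by
  obtain ⟨B, hB, rfl⟩ := CStarAlgebra.isStrictlyPositive_iff_eq_star_mul_self.mp
    hJ.isStrictlyPositive
  have hd : IsUnit B.det := (Matrix.isUnit_iff_isUnit_det B).mp hB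
  refine ⟨B⁻¹, (Matrix.isUnit_nonsing_inv_det B hd).ne_zero, ?_⟩
  rw [Matrix.star_eq_conjTranspose, Matrix.conjTranspose_eq_transpose_of_trivial,
    ← Matrix.mul_assoc, ← Matrix.transpose_mul, Matrix.mul_nonsing_inv B hd,
    Matrix.transpose_one, Matrix.one_mul, Matrix.mul_nonsing_inv B hd]

theorem isClosedEmbedding_mulVec {n : ℕ} {A : Matrix (Fin n) (Fin n) ℝ} (hA : A.det ≠ 0) :
    IsClosedEmbedding fun x : Fin n → ℝ => A.mulVec x := by
  have h : LinearMap.ker (Matrix.toLin' A) = ⊥ := LinearMap.ker_eq_bot.mpr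
    (Matrix.mulVec_injective_of_isUnit
      ((Matrix.isUnit_iff_isUnit_det A).mpr (isUnit_iff_ne_zero.mpr hA)))
  exact LinearMap.isClosedEmbedding_of_injective h

theorem integral_comp_mulVec {n : ℕ} {A : Matrix (Fin n) (Fin n) ℝ} (hA : A.det ≠ 0)
    (h : (Fin n → ℝ) → ℝ) : ∫ x, h (A.mulVec x) = |A.det|⁻¹ * ∫ x, h x := by
  have hm := Real.map_matrix_volume_pi_eq_smul_volume_pi hA
  have := (isClosedEmbedding_mulVec hA).measurableEmbedding.integral_map (μ := volume) h
  rw [← this]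
  change ∫ y, h y ∂(Measure.map (Matrix.toLin' A) volume) = _
  rw [hm, integral_smul_measure, ENNReal.toReal_ofReal (abs_nonneg _), abs_inv, smul_eq_mul]

theorem pderiv'_const_mul_comp_mulVec {n : ℕ} {v : (Fin n → ℝ) → ℝ} (hv : ContDiff ℝ 1 v)
    (A : Matrix (Fin n) (Fin n) ℝ) (κ : ℝ) (i : Fin n) (x : Fin n → ℝ) :
    pderiv' (fun y => κ * v (A.mulVec y)) i x =
      κ * ∑ k, A k i * pderiv' v k (A.mulVec x) := by
  have hL : HasFDerivAt (fun y : Fin n → ℝ => A.mulVec y)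
      (LinearMap.toContinuousLinearMap (Matrix.toLin' A)) x :=
    (LinearMap.toContinuousLinearMap (Matrix.toLin' A)).hasFDerivAt
  have h := ((((hv.differentiable one_ne_zero) (A.mulVec x)).hasFDerivAt).comp x hL).const_mul κ
  have hcol : A.mulVec (Pi.single i 1) = ∑ k, A k i • (Pi.single k 1 : Fin n → ℝ) := by
    ext j
    simp [Finset.sum_apply, Pi.single_apply]
  have e : pderiv' (fun y => κ * v (A.mulVec y)) i x =
      κ * fderiv ℝ v (A.mulVec x) (A.mulVec (Pi.single i 1)) := by
    rw [pderiv']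
    exact congrArg (fun T : (Fin n → ℝ) →L[ℝ] ℝ => T (Pi.single i 1)) h.fderiv
  rw [e, hcol, map_sum]
  simp [pderiv']

theorem integrable_pderiv'_mul_pderiv' {n : ℕ} {v : (Fin n → ℝ) → ℝ} (hv : ContDiff ℝ 1 v)
    (hc : HasCompactSupport v) (i j : Fin n) :
    Integrable fun x => pderiv' v i x * pderiv' v j x :=
  integrable_mul_of_hasCompactSupport (continuous_pderiv' hv i) (hasCompactSupport_pderiv' hc i)
    (continuous_pderiv' hv j)

/-- The Euclidean logarithmic Sobolev inequality with the Fisher information matrix. -/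
theorem integral_sq_mul_log_sq_le_log_det {n : ℕ} {v : (Fin n → ℝ) → ℝ} (hv : ContDiff ℝ 1 v)
    (hc : HasCompactSupport v) (hone : ∫ x, v x ^ 2 = 1) {J : Matrix (Fin n) (Fin n) ℝ}
    (hJ : ∀ i j, J i j = 4 * ∫ x, pderiv' v i x * pderiv' v j x) (hpos : J.PosDef) :
    ∫ x, v x ^ 2 * Real.log (v x ^ 2) ≤
      1 / 2 * Real.log J.det - n / 2 - n / 2 * Real.log (2 * Real.pi) := by
  obtain ⟨A, hA, hAJ⟩ := hpos.exists_transpose_mul_mul_eq_one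
  have habs : 0 < |A.det| := abs_pos.mpr hA
  set κ := √|A.det| with hκ
  have hκ2 : κ ^ 2 = |A.det| := Real.sq_sqrt habs.le
  have hscale : ∀ h : (Fin n → ℝ) → ℝ, ∫ x, κ ^ 2 * h (A.mulVec x) = ∫ x, h x := fun h => by
    rw [integral_const_mul, integral_comp_mulVec hA, hκ2, mul_inv_cancel_left₀ habs.ne']
  have hLc : ContDiff ℝ 1 fun x : Fin n → ℝ => A.mulVec x :=
    (LinearMap.toContinuousLinearMap (Matrix.toLin' A)).contDiff
  have hw : ContDiff ℝ 1 fun x => κ * v (A.mulVec x) := contDiff_const.mul (hv.comp hLc)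
  have hwc : HasCompactSupport fun x => κ * v (A.mulVec x) :=
    HasCompactSupport.mul_left (f := fun _ => κ)
      (hc.comp_isClosedEmbedding (isClosedEmbedding_mulVec hA))
  have hw1 : ∫ x, (κ * v (A.mulVec x)) ^ 2 = 1 := by
    simp only [mul_pow]
    rw [hscale fun y => v y ^ 2, hone]
  have hv2 : Integrable fun x => v x ^ 2 :=
    (hv.continuous.pow 2).integrable_of_hasCompactSupport (hasCompactSupport_sq hc)
  have hlhs : ∫ x, (κ * v (A.mulVec x)) ^ 2 * Real.log ((κ * v (A.mulVec x)) ^ 2) =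
      Real.log |A.det| + ∫ x, v x ^ 2 * Real.log (v x ^ 2) := by
    have h : ∀ x, (κ * v (A.mulVec x)) ^ 2 * Real.log ((κ * v (A.mulVec x)) ^ 2) =
        κ ^ 2 * (v (A.mulVec x) ^ 2 * Real.log |A.det| +
          v (A.mulVec x) ^ 2 * Real.log (v (A.mulVec x) ^ 2)) := fun x => by
      rcases eq_or_ne (v (A.mulVec x)) 0 with h0 | h0
      · simp [h0]
      · rw [mul_pow, hκ2, Real.log_mul habs.ne' (pow_ne_zero 2 h0)]
        ring
    simp only [h]
    rw [hscale fun y => v y ^ 2 * Real.log |A.det| + v y ^ 2 * Real.log (v y ^ 2),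
      integral_add (hv2.mul_const _) (integrable_sq_mul_log_sq hv.continuous hc),
      integral_mul_const, hone, one_mul]
  have hgrad : ∀ i, ∫ x, pderiv' (fun y => κ * v (A.mulVec y)) i x ^ 2 = 1 / 4 := fun i => by
    have h : ∀ x, pderiv' (fun y => κ * v (A.mulVec y)) i x ^ 2 =
        κ ^ 2 * ∑ k, ∑ l, A k i * A l i *
          (pderiv' v k (A.mulVec x) * pderiv' v l (A.mulVec x)) := fun x => by
      rw [pderiv'_const_mul_comp_mulVec hv, mul_pow, sq (∑ k, _), Finset.sum_mul_sum]
      congr 1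
      exact Finset.sum_congr rfl fun k _ => Finset.sum_congr rfl fun l _ => by ring
    have hint := fun k l => (integrable_pderiv'_mul_pderiv' hv hc k l).const_mul (A k i * A l i)
    simp only [h]
    rw [hscale fun y => ∑ k, ∑ l, A k i * A l i * (pderiv' v k y * pderiv' v l y),
      integral_finsetSum _ fun k _ => integrable_finsetSum _ fun l _ => hint k l]
    have h1 : ∑ l, ∑ k, A k i * J k l * A l i = 1 := by
      have := congrFun (congrFun hAJ i) i
      simpa [Matrix.mul_apply, Finset.sum_mul] using this
    rw [Finset.sum_comm] at h1
    rw [← h1, Finset.sum_div]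
    refine Finset.sum_congr rfl fun k _ => ?_
    rw [integral_finsetSum _ fun l _ => hint k l, Finset.sum_div]
    refine Finset.sum_congr rfl fun l _ => ?_
    rw [integral_const_mul, hJ]
    ring
  have hdet : Real.log J.det = -2 * Real.log |A.det| := by
    have h := congrArg Matrix.det hAJ
    rw [Matrix.det_mul, Matrix.det_mul, Matrix.det_transpose, Matrix.det_one] at h
    have hJd : J.det = (|A.det| ^ 2)⁻¹ := by
      rw [sq_abs]
      field_simp
      linear_combination h
    rw [hJd, Real.log_inv, Real.log_pow]
    push_cast; ring
  have key := integral_sq_mul_log_sq_le hw hwc hw1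
  rw [hlhs] at key
  simp only [hgrad, Finset.sum_const, Finset.card_univ, Fintype.card_fin, nsmul_eq_mul] at key
  rw [hdet]
  linarith

theorem posSemidef_integral_gram {α : Type*} [MeasurableSpace α] {μ : Measure α} {n : ℕ}
    {d : Fin n → α → ℝ} (hd : ∀ i j, Integrable (fun x => d i x * d j x) μ) :
    (Matrix.of fun i j => ∫ x, d i x * d j x ∂μ).PosSemidef := by
  refine .of_dotProduct_mulVec_nonneg ?_ fun c => ?_
  · ext i j
    simp [mul_comm]
  · have h : ∑ i, ∑ j, c i * c j * ∫ x, d i x * d j x ∂μ = ∫ x, (∑ i, c i * d i x) ^ 2 ∂μ := by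
      have e : ∀ x, (∑ i, c i * d i x) ^ 2 = ∑ i, ∑ j, c i * c j * (d i x * d j x) := fun x => by
        rw [sq, Finset.sum_mul_sum]
        exact Finset.sum_congr rfl fun i _ => Finset.sum_congr rfl fun j _ => by ring
      simp only [e]
      rw [integral_finsetSum _ fun i _ => integrable_finsetSum _ fun j _ =>
        (hd i j).const_mul (c i * c j)]
      refine Finset.sum_congr rfl fun i _ => ?_
      rw [integral_finsetSum _ fun j _ => (hd i j).const_mul (c i * c j)]
      exact Finset.sum_congr rfl fun j _ => (integral_const_mul _ _).symm
    have e : star c ⬝ᵥ (Matrix.of fun i j => ∫ x, d i x * d j x ∂μ).mulVec c =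
        ∑ i, ∑ j, c i * c j * ∫ x, d i x * d j x ∂μ := by
      simp only [dotProduct, Matrix.mulVec, Matrix.of_apply, Finset.mul_sum, Pi.star_apply,
        star_trivial]
      exact Finset.sum_congr rfl fun i _ => Finset.sum_congr rfl fun j _ => by ring
    rw [e, h]
    exact integral_nonneg fun x => sq_nonneg _

/-- **Intrinsic dimensional log-Sobolev inequality in normalized form** (Lemma 4.2):
if `u ∈ C_c^∞(ℝⁿ)` satisfies `‖u‖_{L₂(γₙ)} = 1` and `∫ xᵢxⱼ u² dγₙ = δᵢⱼ`, then
`Ent_{γₙ}[u²] ≤ (1/2) log det(4 ∫ (∇u)^{⊗2} dγₙ + Idₙ)`. -/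
theorem stmt_5 {n : ℕ} (u : (Fin n → ℝ) → ℝ)
    (hu : ContDiff ℝ (⊤ : ℕ∞) u) (hu' : HasCompactSupport u)
    (hnorm : (∫ x, (u x) ^ 2 ∂(stdGauss n)) = 1)
    (hmom : ∀ i j : Fin n,
      (∫ x, x i * x j * (u x) ^ 2 ∂(stdGauss n)) = if i = j then 1 else 0) :
    (∫ x, (u x) ^ 2 * Real.log ((u x) ^ 2) ∂(stdGauss n)) -
        (∫ x, (u x) ^ 2 ∂(stdGauss n)) * Real.log (∫ x, (u x) ^ 2 ∂(stdGauss n)) ≤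
      (1 / 2 : ℝ) * Real.log (Matrix.det
        ((Matrix.of fun i j : Fin n =>
            4 * ∫ x, pderiv' u i x * pderiv' u j x ∂(stdGauss n)) +
          (1 : Matrix (Fin n) (Fin n) ℝ))) := by
  have hu1 : ContDiff ℝ 1 u := hu.of_le (by exact_mod_cast le_top)
  rw [hnorm, Real.log_one, mul_zero, sub_zero]
  set τ : (Fin n → ℝ) → ℝ := gaussWeight ((2 * Real.pi) ^ (-(n : ℝ) / 4)) (-(1 / 4)) with hτ
  have hτpos : ∀ x, 0 < τ x := fun x => by simp only [hτ, gaussWeight]; positivity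
  have hτ2 : ∀ x, ∏ i, gaussianPDFReal 0 1 (x i) = τ x ^ 2 := fun x => by
    rw [prod_gaussianPDFReal, hτ, gaussWeight, mul_pow, ← Real.exp_nat_mul, ← Real.rpow_natCast,
      ← Real.rpow_mul (by positivity)]
    push_cast
    ring_nf
  have hlog : ∀ x, Real.log (τ x ^ 2) = -(n / 2 * Real.log (2 * Real.pi)) - (∑ i, x i ^ 2) / 2 :=
    fun x => by
      rw [hτ, gaussWeight, Real.log_pow, Real.log_mul (by positivity) (by positivity),
        Real.log_exp, Real.log_rpow (by positivity)]
      push_cast; ring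
  have hτc : ContDiff ℝ 1 τ := contDiff_gaussWeight _ _
  set v : (Fin n → ℝ) → ℝ := fun x => u x * τ x with hv
  have hvd : ContDiff ℝ 1 v := hu1.mul hτc
  have hvs : HasCompactSupport v := hu'.mul_right
  have hvc := hvd.continuous
  have hone : ∫ x, v x ^ 2 = 1 := by
    rw [← hnorm, integral_stdGauss]
    refine integral_congr_ae (ae_of_all _ fun x => ?_)
    simp only [hτ2, hv]
    ring
  have hxx : ∀ i j, ∫ x, x i * x j * v x ^ 2 = if i = j then 1 else 0 := fun i j => by
    rw [← hmom, integral_stdGauss]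
    refine integral_congr_ae (ae_of_all _ fun x => ?_)
    simp only [hτ2, hv]
    ring
  have ixx : ∀ i j, Integrable fun x => x i * x j * v x ^ 2 := fun i j =>
    Continuous.integrable_of_hasCompactSupport (by fun_prop) (hasCompactSupport_sq hvs).mul_left
  have hgrad : ∀ i x, pderiv' v i x = pderiv' u i x * τ x - x i * v x / 2 := fun i x => by
    rw [hv, hτ, pderiv'_mul_gaussWeight hu1]
    ring
  have hJ : ∀ i j, ((Matrix.of fun i j : Fin n =>
      4 * ∫ x, pderiv' u i x * pderiv' u j x ∂(stdGauss n)) +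
        (1 : Matrix (Fin n) (Fin n) ℝ)) i j = 4 * ∫ x, pderiv' v i x * pderiv' v j x := by
    intro i j
    have hdc := continuous_pderiv' hvd
    have e : ∀ x, (∏ k, gaussianPDFReal 0 1 (x k)) * (pderiv' u i x * pderiv' u j x) =
        pderiv' v i x * pderiv' v j x + v x * pderiv' v i x * x j / 2 +
          v x * pderiv' v j x * x i / 2 + x i * x j * v x ^ 2 / 4 := fun x => by
      rw [hτ2, hgrad, hgrad]
      ring
    have i1 := integrable_pderiv'_mul_pderiv' hvd hvs i j
    have i2 : ∀ i j, Integrable fun x => v x * pderiv' v i x * x j / 2 := fun i j =>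
      (integrable_mul_of_hasCompactSupport (hvc.mul (hdc i)) hvs.mul_right
        (continuous_apply j)).div_const 2
    rw [Matrix.add_apply, Matrix.of_apply, Matrix.one_apply, integral_stdGauss]
    simp only [e]
    rw [integral_add ((i1.fun_add (i2 i j)).fun_add (i2 j i)) ((ixx i j).div_const 4),
      integral_add (i1.fun_add (i2 i j)) (i2 j i), integral_add i1 (i2 i j), integral_div,
      integral_div, integral_div, integral_mul_pderiv'_mul_coord hvd hvs,
      integral_mul_pderiv'_mul_coord hvd hvs, hxx, hone]
    rcases eq_or_ne i j with h | h
    · simp only [h, if_true]; ring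
    · simp only [h, h.symm, if_false]; ring
  have hpos : ((Matrix.of fun i j : Fin n =>
      4 * ∫ x, pderiv' u i x * pderiv' u j x ∂(stdGauss n)) +
        (1 : Matrix (Fin n) (Fin n) ℝ)).PosDef := by
    refine Matrix.PosDef.posSemidef_add ?_ Matrix.PosDef.one
    have hg := posSemidef_integral_gram (μ := volume)
      (d := fun i x => 2 * (pderiv' u i x * τ x)) fun i j => by
        have := continuous_pderiv' hu1
        have := hτc.continuous
        exact integrable_mul_of_hasCompactSupport (by fun_prop)
          (HasCompactSupport.mul_left (f := fun _ => (2 : ℝ))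
            (hasCompactSupport_pderiv' hu' i).mul_right) (by fun_prop)
    convert hg using 4 with i j
    rw [integral_stdGauss, ← integral_const_mul]
    refine integral_congr_ae (ae_of_all _ fun x => ?_)
    simp only [hτ2]
    ring
  have key := integral_sq_mul_log_sq_le_log_det hvd hvs hone hJ hpos
  have hent : ∫ x, u x ^ 2 * Real.log (u x ^ 2) ∂(stdGauss n) =
      (∫ x, v x ^ 2 * Real.log (v x ^ 2)) + n / 2 * Real.log (2 * Real.pi) + n / 2 := by
    have e : ∀ x, (∏ k, gaussianPDFReal 0 1 (x k)) * (u x ^ 2 * Real.log (u x ^ 2)) =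
        v x ^ 2 * Real.log (v x ^ 2) + v x ^ 2 * (n / 2 * Real.log (2 * Real.pi)) +
          (∑ i, x i * x i * v x ^ 2) / 2 := fun x => by
      have hs : ∑ i, x i * x i * v x ^ 2 = v x ^ 2 * ∑ i, x i ^ 2 := by
        rw [Finset.mul_sum]
        exact Finset.sum_congr rfl fun i _ => by ring
      rw [hs, hτ2]
      rcases eq_or_ne (u x) 0 with h0 | h0
      · simp [hv, h0]
      · have hl : Real.log (v x ^ 2) = Real.log (u x ^ 2) + Real.log (τ x ^ 2) := by
          rw [hv, mul_pow, Real.log_mul (pow_ne_zero 2 h0) (pow_ne_zero 2 (hτpos x).ne')]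
        rw [hl, hlog]
        simp only [hv]
        ring
    have hv2 : Integrable fun x => v x ^ 2 :=
      (hvc.pow 2).integrable_of_hasCompactSupport (hasCompactSupport_sq hvs)
    have hvl := integrable_sq_mul_log_sq hvc hvs
    rw [integral_stdGauss]
    simp only [e]
    rw [integral_add (hvl.fun_add (hv2.mul_const _))
      ((integrable_finsetSum _ fun i _ => ixx i i).div_const 2),
      integral_add hvl (hv2.mul_const _), integral_mul_const, hone, one_mul, integral_div,
      integral_finsetSum _ fun i _ => ixx i i]
    simp [hxx]
  rw [hent]
  linarith
end

section
/- For every q ∈ (1,2) there exists a constant C̃_q > 0 such that for every n ∈ ℕ and every probability measure μ on ℝ^n with positive differentiable density g with respect to Lebesgue measure (with all appearing integrals finite), H(μ‖λ_n) ≤ C̃_q · Σ_{i=1}^n ∫_{ℝ^n} ( |∂_i g(x)/g(x)|^q + |x_i|^{q/(q−1)} ) dμ(x). -/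
open MeasureTheory

/-- A differentiable integrable function on the line is bounded by the integral of any integrable
bound of its derivative. -/
theorem le_integral_of_abs_deriv_le {u v : ℝ → ℝ} (hu : Differentiable ℝ u)
    (hui : Integrable u) (hvi : Integrable v) (huv : ∀ t, |deriv u t| ≤ v t) (t : ℝ) :
    u t ≤ ∫ s, v s := by
  have hd : Integrable (deriv u) :=
    hvi.mono' (measurable_deriv u).aestronglyMeasurable (Filter.Eventually.of_forall huv)
  have hlim : Filter.Tendsto u Filter.atBot (nhds 0) :=
    tendsto_zero_of_hasDerivAt_of_integrableOn_Iic (a := 0)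
      (fun x _ => (hu x).hasDerivAt) hd.integrableOn hui.integrableOn
  have hftc := integral_Iic_of_hasDerivAt_of_tendsto' (a := t)
    (fun x _ => (hu x).hasDerivAt) hd.integrableOn hlim
  calc u t = ∫ s in Set.Iic t, deriv u s := by rw [hftc, sub_zero]
    _ ≤ ∫ s in Set.Iic t, v s :=
        integral_mono hd.integrableOn hvi.integrableOn fun s => (le_abs_self _).trans (huv s)
    _ ≤ ∫ s, v s :=
        setIntegral_le_integral hvi
          (Filter.Eventually.of_forall fun s => (abs_nonneg _).trans (huv s))

/-- Integrals along coordinate lines depend measurably on the base point. -/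
theorem measurable_lintegral_update {n : ℕ} {φ : (Fin n → ℝ) → ENNReal} (hφ : Measurable φ)
    (i : Fin n) : Measurable fun x : Fin n → ℝ => ∫⁻ t, φ (Function.update x i t) := by
  rw [← lmarginal_singleton (μ := fun _ : Fin n => (volume : Measure ℝ)) φ i]
  exact hφ.lmarginal _

/-- Averaging `k` along the `i`-th coordinate lines with weight `f` does not increase its total
integral. -/
theorem lintegral_mul_div_lintegral_update_le {n : ℕ} {f k : (Fin n → ℝ) → ENNReal}
    (hf : Measurable f) (hk : Measurable k) (i : Fin n) :
    ∫⁻ x, f x * ((∫⁻ t, k (Function.update x i t)) / ∫⁻ t, f (Function.update x i t))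
      ≤ ∫⁻ x, k x := by
  rw [volume_pi]
  refine lintegral_le_of_lmarginal_le {i} (hf.mul ((measurable_lintegral_update hk i).div
    (measurable_lintegral_update hf i))) hk ?_
  intro x
  simp only [lmarginal_singleton, Function.update_idem]
  have hline : Measurable fun t => f (Function.update x i t) := hf.comp (measurable_update x)
  rw [lintegral_mul_const _ hline, ← mul_div_assoc, mul_comm,
    mul_div_assoc]
  exact mul_le_of_le_one_right' ENNReal.div_self_le_one

/-- Pointwise linearisation of the entropy: if `u ≤ b i + a i` for all `i`, then `p u log u` is
controlled by a grid-lines weight and the ratios `b i / a i`. -/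
theorem mul_log_le_of_le_add {n : ℕ} {p u : ℝ} (hp : 0 < p) (hu : 0 < u) {a b : Fin n → ℝ}
    (ha : ∀ i, 0 < a i) (hab : ∀ i, u ≤ b i + a i) :
    p * (u * Real.log u) ≤ u ^ (1 - ((n : ℝ) - 1) * p) * ∏ i, a i ^ p - u
      + p * ∑ i, u * (b i / a i) := by
  have hlog : ∀ i, Real.log u - Real.log (a i) ≤ b i / a i := by
    intro i
    rw [← Real.log_div hu.ne' (ha i).ne']
    have h₁ := Real.log_le_sub_one_of_pos (div_pos hu (ha i))
    have h₂ : u / a i ≤ b i / a i + 1 := by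
      rw [div_add_one (ha i).ne']
      exact div_le_div_of_nonneg_right (hab i) (ha i).le
    linarith
  have hprod : 0 < ∏ i, a i ^ p := Finset.prod_pos fun i _ => Real.rpow_pos_of_pos (ha i) p
  have hpow : 0 < u ^ (-((n : ℝ) - 1) * p) := Real.rpow_pos_of_pos hu _
  have hweight : u ^ (1 - ((n : ℝ) - 1) * p) * ∏ i, a i ^ p
      = u * (u ^ (-((n : ℝ) - 1) * p) * ∏ i, a i ^ p) := by
    rw [sub_eq_add_neg, Real.rpow_add hu, Real.rpow_one, neg_mul, mul_assoc]
  have hy := Real.log_le_sub_one_of_pos (mul_pos hpow hprod)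
  rw [Real.log_mul hpow.ne' hprod.ne', Real.log_rpow hu,
    Real.log_prod fun i _ => (Real.rpow_pos_of_pos (ha i) p).ne'] at hy
  simp only [Real.log_rpow (ha _), ← Finset.mul_sum] at hy
  have hsum : (n : ℝ) * Real.log u - ∑ i, Real.log (a i) ≤ ∑ i, b i / a i := by
    simpa [Finset.sum_sub_distrib] using Finset.sum_le_sum fun i (_ : i ∈ Finset.univ) => hlog i
  rw [hweight, ← Finset.mul_sum]
  have hpsum := mul_le_mul_of_nonneg_left hsum hp.le
  have key : p * Real.log u ≤ (u ^ (-((n : ℝ) - 1) * p) * ∏ i, a i ^ p) - 1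
      + p * ∑ i, b i / a i := by linarith
  linarith [mul_le_mul_of_nonneg_left key hu.le]

/-- Dimension-free entropy bound for a positive density whose partial derivatives are dominated by
`K i + g`. -/
theorem integral_mul_log_le_sum_of_abs_pderiv_le {n : ℕ} {g : (Fin n → ℝ) → ℝ}
    {K : Fin n → (Fin n → ℝ) → ℝ} (hg : Differentiable ℝ g) (hpos : ∀ x, 0 < g x)
    (hint : ∫ x, g x = 1) (hent : Integrable fun x => g x * Real.log (g x))
    (hKm : ∀ i, Measurable (K i)) (hK0 : ∀ i x, 0 ≤ K i x) (hKi : ∀ i, Integrable (K i))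
    (hgK : ∀ i x, |pderiv' g i x| ≤ K i x + g x) :
    ∫ x, g x * Real.log (g x) ≤ ∑ i, ∫ x, K i x := by
  have hgi : Integrable g := by
    by_contra h
    rw [integral_undef h] at hint
    exact zero_ne_one hint
  set f : (Fin n → ℝ) → ENNReal := fun x => ENNReal.ofReal (g x) with hf
  set k : Fin n → (Fin n → ℝ) → ENNReal := fun i x => ENNReal.ofReal (K i x) with hk
  set A : Fin n → (Fin n → ℝ) → ENNReal := fun i x => ∫⁻ t, f (Function.update x i t) with hA
  set B : Fin n → (Fin n → ℝ) → ENNReal := fun i x => ∫⁻ t, k i (Function.update x i t)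
  have hfm : Measurable f := hg.continuous.measurable.ennreal_ofReal
  have hkm : ∀ i, Measurable (k i) := fun i => (hKm i).ennreal_ofReal
  have hAm : ∀ i, Measurable (A i) := fun i => measurable_lintegral_update hfm i
  have hBm : ∀ i, Measurable (B i) := fun i => measurable_lintegral_update (hkm i) i
  have hf0 : ∀ x, f x ≠ 0 := fun x => (ENNReal.ofReal_pos.2 (hpos x)).ne'
  have hA0 : ∀ i x, A i x ≠ 0 := by
    intro i x h
    rw [hA] at h
    have := (lintegral_eq_zero_iff (hfm.comp (measurable_update x))).1 h
    obtain ⟨t, ht⟩ := this.exists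
    exact hf0 _ ht
  obtain ⟨p, hp0, hp1⟩ : ∃ p : ℝ, 0 < p ∧ ((n : ℝ) - 1) * p ≤ 1 := by
    refine ⟨1 / (n + 1), by positivity, ?_⟩
    rw [mul_one_div, div_le_one (by positivity)]
    linarith
  set T : (Fin n → ℝ) → ENNReal :=
    fun x => f x ^ (1 - ((n : ℝ) - 1) * p) * ∏ i, A i x ^ p with hT
  set S : Fin n → (Fin n → ℝ) → ENNReal := fun i x => f x * (B i x / A i x) with hS
  have hTm : Measurable T :=
    (hfm.pow_const _).mul (Finset.measurable_prod _ fun i _ => (hAm i).pow_const _)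
  have hSm : ∀ i, Measurable (S i) := fun i => hfm.mul ((hBm i).div (hAm i))
  have hTle : ∫⁻ x, T x ≤ 1 := by
    have h := lintegral_mul_prod_lintegral_pow_le (fun _ : Fin n => (volume : Measure ℝ))
      hp0.le (by simpa using hp1) hfm
    have hone : ∫⁻ x, f x = 1 := by
      rw [hf, ← ofReal_integral_eq_lintegral_ofReal hgi
        (Filter.Eventually.of_forall fun x => (hpos x).le), hint, ENNReal.ofReal_one]
    rw [← volume_pi, hone, ENNReal.one_rpow, Fintype.card_fin] at h
    exact h
  have hSle : ∀ i, ∫⁻ x, S i x ≤ ENNReal.ofReal (∫ x, K i x) := by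
    intro i
    rw [ofReal_integral_eq_lintegral_ofReal (hKi i) (Filter.Eventually.of_forall (hK0 i))]
    exact lintegral_mul_div_lintegral_update_le hfm (hkm i) i
  have hTfin : ∫⁻ x, T x ≠ ⊤ := ne_top_of_le_ne_top ENNReal.one_ne_top hTle
  have hSfin : ∀ i, ∫⁻ x, S i x ≠ ⊤ := fun i => ne_top_of_le_ne_top ENNReal.ofReal_ne_top (hSle i)
  have hTi : Integrable fun x => (T x).toReal :=
    integrable_toReal_of_lintegral_ne_top hTm.aemeasurable hTfin
  have hSi : ∀ i, Integrable fun x => (S i x).toReal := fun i =>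
    integrable_toReal_of_lintegral_ne_top (hSm i).aemeasurable (hSfin i)
  have hpt : ∀ᵐ x, p * (g x * Real.log (g x)) ≤ (T x).toReal - g x + p * ∑ i, (S i x).toReal := by
    have hTae := ae_lt_top hTm hTfin
    have hSae : ∀ᵐ x, ∀ i, S i x < ⊤ :=
      ae_all_iff.2 fun i => ae_lt_top (hSm i) (hSfin i)
    filter_upwards [hTae, hSae] with x hTx hSx
    have hAtop : ∀ i, A i x ≠ ⊤ := by
      intro i hi
      refine hTx.ne ?_
      have hAp : ∀ j, A j x ^ p ≠ 0 := fun j => by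
        simp [ENNReal.rpow_eq_zero_iff, hA0 j x, hp0, hp0.le]
      have : ∏ j, A j x ^ p = ⊤ := by
        rw [← Finset.mul_prod_erase _ _ (Finset.mem_univ i), hi, ENNReal.top_rpow_of_pos hp0]
        exact ENNReal.top_mul (Finset.prod_ne_zero_iff.2 fun j _ => hAp j)
      rw [hT]
      simp only [this]
      exact ENNReal.mul_top (by simp [ENNReal.rpow_eq_zero_iff, hf, (hpos x).not_ge])
    have hBtop : ∀ i, B i x ≠ ⊤ := by
      intro i hi
      refine (hSx i).ne ?_
      rw [hS]
      simp only [hi, ENNReal.top_div_of_ne_top (hAtop i)]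
      exact ENNReal.mul_top (hf0 x)
    have hline : ∀ i, g x ≤ (B i x).toReal + (A i x).toReal := by
      intro i
      have hcont : Measurable fun t : ℝ => Function.update x i t := measurable_update x
      have hgl : Integrable fun t : ℝ => g (Function.update x i t) := by
        have := integrable_toReal_of_lintegral_ne_top (hfm.comp hcont).aemeasurable (hAtop i)
        simpa [hf, Function.comp_def, (hpos _).le] using this
      have hKl : Integrable fun t : ℝ => K i (Function.update x i t) := by
        have := integrable_toReal_of_lintegral_ne_top ((hkm i).comp hcont).aemeasurable (hBtop i)
        simpa [hk, Function.comp_def, hK0 i _] using this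
      have hder : ∀ t, HasDerivAt (fun t : ℝ => g (Function.update x i t))
          (pderiv' g i (Function.update x i t)) t := fun t =>
        (hg _).hasFDerivAt.comp_hasDerivAt t (hasDerivAt_update x i t)
      have h := le_integral_of_abs_deriv_le (fun t => (hder t).differentiableAt) hgl
        (hKl.add hgl) (fun t => by rw [(hder t).deriv]; exact hgK i _) (x i)
      rw [Function.update_eq_self, integral_add' hKl hgl,
        integral_eq_lintegral_of_nonneg_ae (Filter.Eventually.of_forall fun t => hK0 i _)
          hKl.aestronglyMeasurable,
        integral_eq_lintegral_of_nonneg_ae (Filter.Eventually.of_forall fun t => (hpos _).le)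
          hgl.aestronglyMeasurable] at h
      exact h
    have h := mul_log_le_of_le_add hp0 (hpos x)
      (fun i => ENNReal.toReal_pos (hA0 i x) (hAtop i)) hline
    simpa [hT, hS, hf, ENNReal.toReal_mul, ENNReal.toReal_prod, ENNReal.toReal_div,
      ← ENNReal.toReal_rpow, ENNReal.toReal_ofReal (hpos x).le] using h
  have hTint : ∫ x, (T x).toReal ≤ 1 := by
    rw [integral_toReal hTm.aemeasurable (ae_lt_top hTm hTfin)]
    exact ENNReal.toReal_le_of_le_ofReal zero_le_one (by simpa using hTle)
  have hSint : ∀ i, ∫ x, (S i x).toReal ≤ ∫ x, K i x := by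
    intro i
    rw [integral_toReal (hSm i).aemeasurable (ae_lt_top (hSm i) (hSfin i))]
    exact ENNReal.toReal_le_of_le_ofReal (integral_nonneg (hK0 i)) (hSle i)
  have hsumi : Integrable fun x => p * ∑ i, (S i x).toReal :=
    (integrable_finsetSum _ fun i _ => hSi i).const_mul p
  have h := integral_mono_ae (hent.const_mul p) ((hTi.sub hgi).add hsumi) hpt
  rw [integral_add' (hTi.sub hgi) hsumi, integral_sub' hTi hgi, integral_const_mul,
    integral_const_mul, integral_finsetSum _ fun i _ => hSi i, hint] at h
  have hle : p * ∫ x, g x * Real.log (g x) ≤ p * ∑ i, ∫ x, (S i x).toReal := by linarith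
  exact (le_of_mul_le_mul_left hle hp0).trans (Finset.sum_le_sum fun i _ => hSint i)

/-- **Euclidean form of the `q`-logarithmic Sobolev inequality** (Theorem 5.1):
for every `q ∈ (1,2)` there is a constant `C̃_q > 0` such that for every `n` and every
probability measure `μ = g·λₙ` on `ℝⁿ` with positive differentiable density `g`,
`H(μ‖λₙ) ≤ C̃_q ∑ᵢ ∫ ( |∂ᵢg/g|^q + |xᵢ|^{q/(q−1)} ) dμ`. -/
theorem stmt_7 (q : ℝ) (hq1 : 1 < q) (hq2 : q < 2) :
    ∃ C : ℝ, 0 < C ∧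
      ∀ (n : ℕ) (g : (Fin n → ℝ) → ℝ),
        Differentiable ℝ g → (∀ x, 0 < g x) → (∫ x : Fin n → ℝ, g x) = 1 →
        Integrable (fun x : Fin n → ℝ => g x * Real.log (g x)) →
        (∀ i : Fin n, Integrable (fun x : Fin n → ℝ =>
          (|pderiv' g i x / g x| ^ q + |x i| ^ (q / (q - 1))) * g x)) →
        (∫ x : Fin n → ℝ, g x * Real.log (g x)) ≤
          C * ∑ i : Fin n, ∫ x : Fin n → ℝ,
            (|pderiv' g i x / g x| ^ q + |x i| ^ (q / (q - 1))) * g x := by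
  refine ⟨1, one_pos, fun n g hg hpos hint hent hK => ?_⟩
  rw [one_mul]
  refine integral_mul_log_le_sum_of_abs_pderiv_le hg hpos hint hent ?_ ?_ hK ?_
  · intro i
    have hd : Measurable fun x => pderiv' g i x := measurable_fderiv_apply_const ℝ g _
    have hm : Measurable g := hg.continuous.measurable
    fun_prop
  · intro i x
    have := (hpos x).le
    positivity
  · intro i x
    have hs : |pderiv' g i x / g x| ≤ |pderiv' g i x / g x| ^ q + |x i| ^ (q / (q - 1)) + 1 := by
      have hx : 0 ≤ |x i| ^ (q / (q - 1)) := by positivity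
      rcases le_total |pderiv' g i x / g x| 1 with h | h
      · have : 0 ≤ |pderiv' g i x / g x| ^ q := by positivity
        linarith
      · have := Real.self_le_rpow_of_one_le h hq1.le
        linarith
    have h := mul_le_mul_of_nonneg_right hs (hpos x).le
    rw [abs_div, abs_of_pos (hpos x), div_mul_cancel₀ _ (hpos x).ne'] at h
    rw [abs_div, abs_of_pos (hpos x)]
    linarith
end

section
/- For every q ∈ (1,2), setting p = q/(q−1), there exists a constant C̃_q > 0 such that for every n ∈ ℕ and every probability measure μ on ℝ^n with positive differentiable density g with respect to Lebesgue measure (with all appearing integrals finite), H(μ‖λ_n) ≤ Σ_{i=1}^n inf_{t_i > 0} { C̃_q · t_i^q · ∫_{ℝ^n} |∂_i g(x)/g(x)|^q dμ(x) + (C̃_q / t_i^p) · ∫_{ℝ^n} |x_i|^p dμ(x) − log t_i }. -/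
open MeasureTheory

/-- The **Loomis–Whitney inequality** on a partial set `s` of coordinates, for functions given as
integrals along coordinate lines. -/
theorem lmarginal_prod_lmarginal_singleton_rpow_le {ι : Type*} [Fintype ι] [DecidableEq ι]
    {X : ι → Type*} [∀ i, MeasurableSpace (X i)] (μ : ∀ i, Measure (X i)) [∀ i, SigmaFinite (μ i)]
    {a : ℝ} (ha : 0 ≤ a) (hcard : ((Fintype.card ι : ℝ) - 1) * a = 1)
    {f : ι → (∀ i, X i) → ENNReal} (hf : ∀ i, Measurable (f i)) (s : Finset ι) (x : ∀ i, X i) :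
    lmarginal μ s (fun y => ∏ i, lmarginal μ {i} (f i) y ^ a) x ≤
      ∏ i, lmarginal μ (insert i s) (f i) x ^ a := by
  induction s using Finset.induction generalizing x with
  | empty => simp
  | insert j s hj ih =>
    have hmeas : Measurable fun y => ∏ i, lmarginal μ {i} (f i) y ^ a :=
      Finset.measurable_fun_prod _ fun i _ => ((hf i).lmarginal μ).pow_const a
    have hline : ∀ i, Measurable fun u => lmarginal μ (insert i s) (f i) (Function.update x j u) :=
      fun i => ((hf i).lmarginal μ).comp (measurable_update x)
    have hconst : ∀ u, lmarginal μ (insert j s) (f j) (Function.update x j u) =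
        lmarginal μ (insert j s) (f j) x :=
      fun u => lmarginal_update_of_mem μ (Finset.mem_insert_self j s) (f j) x u
    calc lmarginal μ (insert j s) (fun y => ∏ i, lmarginal μ {i} (f i) y ^ a) x
        ≤ ∫⁻ u, ∏ i, lmarginal μ (insert i s) (f i) (Function.update x j u) ^ a ∂μ j := by
          rw [lmarginal_insert _ hmeas hj]
          exact lintegral_mono fun u => ih _
      _ = lmarginal μ (insert j s) (f j) x ^ a *
            ∫⁻ u, ∏ i ∈ Finset.univ.erase j,
              lmarginal μ (insert i s) (f i) (Function.update x j u) ^ a ∂μ j := by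
          simp_rw [← Finset.mul_prod_erase _ _ (Finset.mem_univ j), hconst]
          exact lintegral_const_mul _
            (Finset.measurable_fun_prod _ fun i _ => (hline i).pow_const a)
      _ ≤ lmarginal μ (insert j s) (f j) x ^ a * ∏ i ∈ Finset.univ.erase j,
            (∫⁻ u, lmarginal μ (insert i s) (f i) (Function.update x j u) ∂μ j) ^ a := by
          gcongr
          refine ENNReal.lintegral_prod_norm_pow_le _ (fun i _ => (hline i).aemeasurable) ?_
            fun _ _ => ha
          rw [Finset.sum_const, Finset.card_erase_of_mem (Finset.mem_univ j), nsmul_eq_mul,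
            Finset.card_univ, Nat.cast_sub (Fintype.card_pos_iff.2 ⟨j⟩), Nat.cast_one, hcard]
      _ = ∏ i, lmarginal μ (insert i (insert j s)) (f i) x ^ a := by
          rw [← Finset.mul_prod_erase _ _ (Finset.mem_univ j), Finset.insert_idem]
          congr 1
          refine Finset.prod_congr rfl fun i hi => ?_
          have hij : j ∉ insert i s := by
            simp [(Finset.ne_of_mem_erase hi).symm, hj]
          rw [Finset.insert_comm, lmarginal_insert _ (hf i) hij]

/-- A nonnegative function on the line is bounded by the total mass of its derivative plus any
positive multiple of its own mass. -/
theorem ofReal_le_lintegral_abs_deriv_add {h h' : ℝ → ℝ} (hderiv : ∀ s, HasDerivAt h (h' s) s)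
    (hh : ∀ s, 0 ≤ h s) (hh' : Measurable h') {ε : ℝ} (hε : 0 < ε) (x : ℝ) :
    ENNReal.ofReal (h x) ≤ ∫⁻ s, ENNReal.ofReal (|h' s| + ε * h s) := by
  have hcont : Continuous h := continuous_iff_continuousAt.2 fun s => (hderiv s).continuousAt
  have hnonneg : ∀ s, 0 ≤ |h' s| + ε * h s := fun s =>
    add_nonneg (abs_nonneg _) (mul_nonneg hε.le (hh s))
  by_cases htop : ∫⁻ s, ENNReal.ofReal (|h' s| + ε * h s) = ⊤
  · simp [htop]
  have hmeas : Measurable fun s => |h' s| + ε * h s :=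
    hh'.abs.add (hcont.measurable.const_mul ε)
  have hint : Integrable fun s => |h' s| + ε * h s :=
    (lintegral_ofReal_ne_top_iff_integrable hmeas.aestronglyMeasurable
      (Filter.Eventually.of_forall hnonneg)).1 htop
  have hint' : Integrable h' := hint.mono' hh'.aestronglyMeasurable
    (Filter.Eventually.of_forall fun s => by
      simpa using mul_nonneg hε.le (hh s))
  have hinth : Integrable h := by
    have : Integrable fun s => ε * h s := hint.mono' (hcont.const_mul ε).aestronglyMeasurable
      (Filter.Eventually.of_forall fun s => by
        rw [Real.norm_of_nonneg (mul_nonneg hε.le (hh s))]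
        exact le_add_of_nonneg_left (abs_nonneg _))
    simpa [hε.ne'] using this.const_mul ε⁻¹
  have hlim : Filter.Tendsto h Filter.atTop (nhds 0) :=
    tendsto_zero_of_hasDerivAt_of_integrableOn_Ioi (a := x) (fun s _ => hderiv s)
      hint'.integrableOn hinth.integrableOn
  have hftc := integral_Ioi_of_hasDerivAt_of_tendsto' (a := x) (fun s _ => hderiv s)
    hint'.integrableOn hlim
  rw [← ofReal_integral_eq_lintegral_ofReal hint (Filter.Eventually.of_forall hnonneg)]
  refine ENNReal.ofReal_le_ofReal ?_
  calc h x = -∫ s in Set.Ioi x, h' s := by rw [hftc]; ring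
    _ ≤ ∫ s in Set.Ioi x, |h' s| := (neg_le_abs _).trans abs_integral_le_integral_abs
    _ ≤ ∫ s, |h' s| := setIntegral_le_integral hint'.abs
        (Filter.Eventually.of_forall fun s => abs_nonneg _)
    _ ≤ ∫ s, (|h' s| + ε * h s) := integral_mono hint'.abs hint fun s =>
        le_add_of_nonneg_right (mul_nonneg hε.le (hh s))

/-- If a probability density `g` on `ℝⁿ` is dominated by the integrals of `f i` along the lines in
direction `i`, then its entropy is at most the sum of the logarithms of the masses of the `f i`. -/
theorem integral_mul_log_le_sum_log_integral {n : ℕ} {g : (Fin n → ℝ) → ℝ}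
    (hgm : Measurable g) (hg : ∀ x, 0 < g x) (hg1 : ∫ x, g x = 1)
    (hent : Integrable fun x => g x * Real.log (g x)) {f : Fin n → (Fin n → ℝ) → ℝ}
    (hfm : ∀ i, Measurable (f i)) (hf : ∀ i x, 0 ≤ f i x) (hfi : ∀ i, Integrable (f i))
    (hpos : ∀ i, 0 < ∫ x, f i x)
    (hle : ∀ i x, ENNReal.ofReal (g x) ≤ ∫⁻ u, ENNReal.ofReal (f i (Function.update x i u))) :
    ∫ x, g x * Real.log (g x) ≤ ∑ i, Real.log (∫ x, f i x) := by
  have hgi : Integrable g := Integrable.of_integral_ne_zero (by simp [hg1])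
  have hfl : ∀ i, ∫⁻ x, ENNReal.ofReal (f i x) = ENNReal.ofReal (∫ x, f i x) := fun i =>
    (ofReal_integral_eq_lintegral_ofReal (hfi i) (Filter.Eventually.of_forall (hf i))).symm
  have hle' : ∀ i x, ENNReal.ofReal (g x) ≤
      lmarginal (fun _ => volume) {i} (fun y => ENNReal.ofReal (f i y)) x := fun i x => by
    rw [lmarginal_singleton]
    exact hle i x
  obtain _ | _ | m := n
  · have hg_eq : ∀ x, g x = 1 := fun x => by
      rw [← hg1, integral_unique, measureReal_def, volume_pi, Measure.pi_of_empty,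
        measure_univ, ENNReal.toReal_one, one_smul]
      exact congrArg g (Subsingleton.elim _ _)
    simp [hg_eq]
  · have hbound : ∀ x, g x ≤ ∫ x, f 0 x := fun x => by
      have h := hle' 0 x
      rw [show ({0} : Finset (Fin 1)) = Finset.univ from rfl, lmarginal_univ, ← volume_pi,
        hfl] at h
      exact (ENNReal.ofReal_le_ofReal_iff (hpos 0).le).1 h
    calc ∫ x, g x * Real.log (g x) ≤ ∫ x, g x * Real.log (∫ y, f 0 y) :=
          integral_mono hent (hgi.mul_const _) fun x =>
            mul_le_mul_of_nonneg_left (Real.log_le_log (hg x) (hbound x)) (hg x).le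
      _ = ∑ i, Real.log (∫ x, f i x) := by simp [integral_mul_const, hg1]
  · set a : ℝ := ((m : ℝ) + 1)⁻¹
    have ha : 0 < a := by positivity
    have hma : ((m : ℝ) + 1) * a = 1 := mul_inv_cancel₀ (by positivity)
    set K : ℝ := ∏ i, (∫ x, f i x) ^ a with hK_def
    have hK : 0 < K := Finset.prod_pos fun i _ => Real.rpow_pos_of_pos (hpos i) a
    have hpow : ∫⁻ x, ENNReal.ofReal (g x * g x ^ a) ≤ ENNReal.ofReal K := by
      calc ∫⁻ x, ENNReal.ofReal (g x * g x ^ a)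
          ≤ ∫⁻ x, ∏ i, lmarginal (fun _ => volume) {i}
              (fun y => ENNReal.ofReal (f i y)) x ^ a := by
            refine lintegral_mono fun x => ?_
            calc ENNReal.ofReal (g x * g x ^ a)
                = ∏ _i : Fin (m + 1 + 1), ENNReal.ofReal (g x) ^ a := by
                  rw [Finset.prod_const, Finset.card_univ, Fintype.card_fin,
                    ENNReal.ofReal_rpow_of_pos (hg x), ← ENNReal.ofReal_pow (Real.rpow_nonneg (hg x).le a)]
                  congr 1
                  rw [pow_succ, ← Real.rpow_natCast, ← Real.rpow_mul (hg x).le]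
                  push_cast
                  rw [mul_comm a, hma, Real.rpow_one]
              _ ≤ _ := Finset.prod_le_prod' fun i _ => ENNReal.rpow_le_rpow (hle' i x) ha.le
        _ ≤ ∏ i, (∫⁻ x, ENNReal.ofReal (f i x)) ^ a := by
            have h := lmarginal_prod_lmarginal_singleton_rpow_le
              (fun _ : Fin (m + 1 + 1) => (volume : Measure ℝ)) ha.le
              (by rw [Fintype.card_fin]; push_cast; linarith)
              (f := fun i y => ENNReal.ofReal (f i y)) (fun i => (hfm i).ennreal_ofReal)
              Finset.univ 0
            simpa only [Finset.insert_eq_of_mem (Finset.mem_univ _), lmarginal_univ,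
              ← volume_pi] using h
        _ = ENNReal.ofReal K := by
            rw [hK_def, ENNReal.ofReal_prod_of_nonneg fun i _ => by
              exact (Real.rpow_pos_of_pos (hpos i) a).le]
            exact Finset.prod_congr rfl fun i _ => by
              rw [hfl, ENNReal.ofReal_rpow_of_pos (hpos i)]
    have hpow_nonneg : ∀ x, 0 ≤ g x * g x ^ a := fun x =>
      mul_nonneg (hg x).le (Real.rpow_nonneg (hg x).le a)
    have hpow_int : Integrable fun x => g x * g x ^ a :=
      (lintegral_ofReal_ne_top_iff_integrable
        (hgm.mul (hgm.pow_const a)).aestronglyMeasurable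
        (Filter.Eventually.of_forall hpow_nonneg)).1 (hpow.trans_lt ENNReal.ofReal_lt_top).ne
    have hpow_le : ∫ x, g x * g x ^ a ≤ K := by
      rw [← ENNReal.ofReal_le_ofReal_iff hK.le, ofReal_integral_eq_lintegral_ofReal hpow_int
        (Filter.Eventually.of_forall hpow_nonneg)]
      exact hpow
    have hlog : ∀ x, a * (g x * Real.log (g x)) ≤
        K⁻¹ * (g x * g x ^ a) + (Real.log K - 1) * g x := fun x => by
      have hu : 0 < g x ^ a := Real.rpow_pos_of_pos (hg x) a
      have h := Real.log_le_sub_one_of_pos (mul_pos (inv_pos.2 hK) hu)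
      rw [Real.log_mul (inv_pos.2 hK).ne' hu.ne', Real.log_inv, Real.log_rpow (hg x)] at h
      nlinarith [mul_le_mul_of_nonneg_left h (hg x).le]
    have hmain : a * ∫ x, g x * Real.log (g x) ≤ Real.log K := by
      calc a * ∫ x, g x * Real.log (g x) = ∫ x, a * (g x * Real.log (g x)) :=
            (integral_const_mul _ _).symm
        _ ≤ ∫ x, (K⁻¹ * (g x * g x ^ a) + (Real.log K - 1) * g x) :=
            integral_mono (hent.const_mul a)
              ((hpow_int.const_mul _).add (hgi.const_mul _)) hlog
        _ = K⁻¹ * (∫ x, g x * g x ^ a) + (Real.log K - 1) := by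
            rw [integral_add (hpow_int.const_mul _) (hgi.const_mul _), integral_const_mul,
              integral_const_mul, hg1, mul_one]
        _ ≤ K⁻¹ * K + (Real.log K - 1) := by gcongr
        _ = Real.log K := by rw [inv_mul_cancel₀ hK.ne']; ring
    have hlogK : Real.log K = a * ∑ i, Real.log (∫ x, f i x) := by
      rw [hK_def, Real.log_prod fun i _ => (Real.rpow_pos_of_pos (hpos i) a).ne',
        Finset.mul_sum]
      exact Finset.sum_congr rfl fun i _ => Real.log_rpow (hpos i) a
    rw [hlogK] at hmain
    exact le_of_mul_le_mul_left hmain ha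

/-- **Scale-invariant refinement of the `q`-logarithmic Sobolev inequality** (Theorem 5.2):
for every `q ∈ (1,2)` and `p = q/(q−1)` there is a constant `C̃_q > 0` such that for every
`n` and every probability measure `μ = g·λₙ` on `ℝⁿ` with positive differentiable density `g`,
`H(μ‖λₙ) ≤ ∑ᵢ inf_{tᵢ>0} { C̃_q tᵢ^q ∫ |∂ᵢg/g|^q dμ + (C̃_q/tᵢ^p) ∫ |xᵢ|^p dμ − log tᵢ }`.
(The bound by the infimum is expressed by quantifying over all `t` with positive entries.) -/
theorem stmt_8 (q : ℝ) (hq1 : 1 < q) (hq2 : q < 2) :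
    ∃ C : ℝ, 0 < C ∧
      ∀ (n : ℕ) (g : (Fin n → ℝ) → ℝ),
        Differentiable ℝ g → (∀ x, 0 < g x) → (∫ x : Fin n → ℝ, g x) = 1 →
        Integrable (fun x : Fin n → ℝ => g x * Real.log (g x)) →
        (∀ i : Fin n, Integrable (fun x : Fin n → ℝ =>
          |pderiv' g i x / g x| ^ q * g x)) →
        (∀ i : Fin n, Integrable (fun x : Fin n → ℝ =>
          |x i| ^ (q / (q - 1)) * g x)) →
        ∀ t : Fin n → ℝ, (∀ i, 0 < t i) →
        (∫ x : Fin n → ℝ, g x * Real.log (g x)) ≤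
          ∑ i : Fin n,
            (C * t i ^ q * (∫ x : Fin n → ℝ, |pderiv' g i x / g x| ^ q * g x) +
              (C / t i ^ (q / (q - 1))) * (∫ x : Fin n → ℝ, |x i| ^ (q / (q - 1)) * g x) -
              Real.log (t i)) := by
  refine ⟨1, one_pos, fun n g hgd hg hg1 hent hI hM t ht => ?_⟩
  have hgi : Integrable g := Integrable.of_integral_ne_zero (by simp [hg1])
  have hdm : ∀ i, Measurable (pderiv' g i) := fun i => measurable_fderiv_apply_const ℝ g _
  have hε : ∀ i, 0 < (2 * t i)⁻¹ := fun i => inv_pos.2 (mul_pos two_pos (ht i))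
  have hyoung : ∀ i x, t i * |pderiv' g i x| ≤
      t i ^ q / q * (|pderiv' g i x / g x| ^ q * g x) + (1 - q⁻¹) * g x := fun i x => by
    have hd : |pderiv' g i x| = |pderiv' g i x / g x| * g x := by
      rw [abs_div, abs_of_pos (hg x), div_mul_cancel₀ _ (hg x).ne']
    have h := Real.young_inequality_of_nonneg
      (mul_nonneg (ht i).le (abs_nonneg (pderiv' g i x / g x))) zero_le_one
      (Real.HolderConjugate.conjExponent hq1)
    rw [Real.mul_rpow (ht i).le (abs_nonneg _), Real.one_rpow, mul_one, one_div,
      ← (Real.HolderConjugate.conjExponent hq1).one_sub_inv] at h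
    calc t i * |pderiv' g i x| = t i * |pderiv' g i x / g x| * g x := by rw [hd]; ring
      _ ≤ (t i ^ q * |pderiv' g i x / g x| ^ q / q + (1 - q⁻¹)) * g x :=
          mul_le_mul_of_nonneg_right h (hg x).le
      _ = _ := by ring
  have hbound_int : ∀ i, Integrable fun x =>
      t i ^ q / q * (|pderiv' g i x / g x| ^ q * g x) + (1 - q⁻¹) * g x :=
    fun i => ((hI i).const_mul _).add (hgi.const_mul _)
  have htd_int : ∀ i, Integrable fun x => t i * |pderiv' g i x| := fun i =>
    (hbound_int i).mono' ((hdm i).abs.const_mul _).aestronglyMeasurable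
      (Filter.Eventually.of_forall fun x => by
        rw [Real.norm_of_nonneg (mul_nonneg (ht i).le (abs_nonneg _))]
        exact hyoung i x)
  have hd_int : ∀ i, Integrable fun x => |pderiv' g i x| := fun i => by
    simpa [(ht i).ne'] using (htd_int i).const_mul (t i)⁻¹
  have hf_int : ∀ i, Integrable fun x => |pderiv' g i x| + (2 * t i)⁻¹ * g x :=
    fun i => (hd_int i).add (hgi.const_mul _)
  have hf_eq : ∀ i, ∫ x, (|pderiv' g i x| + (2 * t i)⁻¹ * g x) =
      (∫ x, |pderiv' g i x|) + (2 * t i)⁻¹ := fun i => by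
    rw [integral_add (hd_int i) (hgi.const_mul _), integral_const_mul, hg1, mul_one]
  have hf_pos : ∀ i, 0 < ∫ x, (|pderiv' g i x| + (2 * t i)⁻¹ * g x) := fun i => by
    rw [hf_eq]
    exact add_pos_of_nonneg_of_pos (integral_nonneg fun x => abs_nonneg _) (hε i)
  refine (integral_mul_log_le_sum_log_integral hgd.continuous.measurable hg hg1 hent
    (f := fun i x => |pderiv' g i x| + (2 * t i)⁻¹ * g x)
    (fun i => (hdm i).abs.add (hgd.continuous.measurable.const_mul _))
    (fun i x => add_nonneg (abs_nonneg _) (mul_nonneg (hε i).le (hg x).le))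
    hf_int hf_pos fun i x => ?_).trans (Finset.sum_le_sum fun i _ => ?_)
  · have hderiv : ∀ s, HasDerivAt (fun u => g (Function.update x i u))
        (pderiv' g i (Function.update x i s)) s := fun s =>
      (hgd _).hasFDerivAt.comp_hasDerivAt s (hasDerivAt_update x i s)
    simpa using ofReal_le_lintegral_abs_deriv_add hderiv (fun s => (hg _).le)
      ((hdm i).comp (measurable_update x)) (hε i) (x i)
  · have hmass : t i * ∫ x, |pderiv' g i x| ≤
        t i ^ q / q * (∫ x, |pderiv' g i x / g x| ^ q * g x) + (1 - q⁻¹) := by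
      have h := integral_mono (htd_int i) (hbound_int i) (hyoung i)
      rwa [integral_const_mul, integral_add ((hI i).const_mul _) (hgi.const_mul _),
        integral_const_mul, integral_const_mul, hg1, mul_one] at h
    have hlog := Real.log_le_sub_one_of_pos (mul_pos (ht i) (hf_pos i))
    rw [Real.log_mul (ht i).ne' (hf_pos i).ne', hf_eq, mul_add,
      show t i * (2 * t i)⁻¹ = 1 / 2 by field_simp [(ht i).ne']] at hlog
    have hfisher : 0 ≤ ∫ x, |pderiv' g i x / g x| ^ q * g x :=
      integral_nonneg fun x => mul_nonneg (Real.rpow_nonneg (abs_nonneg _) q) (hg x).le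
    have hmoment : 0 ≤ 1 / t i ^ (q / (q - 1)) * ∫ x, |x i| ^ (q / (q - 1)) * g x :=
      mul_nonneg (one_div_nonneg.2 (Real.rpow_nonneg (ht i).le _))
        (integral_nonneg fun x => mul_nonneg (Real.rpow_nonneg (abs_nonneg _) _) (hg x).le)
    have hq_inv : 1 / 2 ≤ q⁻¹ := by
      rw [one_div]
      exact inv_anti₀ (by linarith) hq2.le
    have hfisher_le : t i ^ q / q * (∫ x, |pderiv' g i x / g x| ^ q * g x) ≤
        1 * t i ^ q * ∫ x, |pderiv' g i x / g x| ^ q * g x := by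
      rw [one_mul]
      exact mul_le_mul_of_nonneg_right
        (div_le_self (Real.rpow_nonneg (ht i).le q) hq1.le) hfisher
    simp only [hf_eq]
    linarith
end
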